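/- Suppose ν > 0 and Y¹, Y² are real-valued radially symmetric Schwartz functions on ℝ^N with ‖Y¹‖_{L²} = ‖Y²‖_{L²} = 1 satisfying Δ²Y¹ − ((N+4)/(N−4))·W^{8/(N−4)}·Y¹ = −ν·Y² and Δ²Y² − W^{8/(N−4)}·Y² = ν·Y¹. Then there exist constants c > 0 and C > 0 such that for every real-valued radially symmetric Schwartz function g on ℝ^N, ∫_{ℝ^N} |Δg|² dx − ((N+4)/(N−4))·∫_{ℝ^N} W^{8/(N−4)}·g² dx ≥ c·∫_{ℝ^N} |Δg|² dx − C·( (∫_{ℝ^N} W·g dx)² + (∫_{ℝ^N} Y²·g dx)² ). -/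

import Mathlib

open MeasureTheory

noncomputable section

abbrev Rn (N : ℕ) : Type := EuclideanSpace ℝ (Fin N)

noncomputable def lapR {N : ℕ} (u : Rn N → ℝ) (x : Rn N) : ℝ :=
  ∑ i : Fin N, iteratedFDeriv ℝ 2 u x (fun _ => EuclideanSpace.single i 1)

noncomputable def lapC {N : ℕ} (u : Rn N → ℂ) (x : Rn N) : ℂ :=
  ∑ i : Fin N, iteratedFDeriv ℝ 2 u x (fun _ => EuclideanSpace.single i 1)

noncomputable def Wfun (N : ℕ) (x : Rn N) : ℝ :=
  ((N : ℝ) * ((N : ℝ) - 4) * ((N : ℝ) ^ 2 - 4)) ^ (((N : ℝ) - 4) / 8) *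
    (1 + ‖x‖ ^ 2) ^ (-(((N : ℝ) - 4) / 2))

noncomputable def LamR {N : ℕ} (v : Rn N → ℝ) (x : Rn N) : ℝ :=
  (((N : ℝ) - 4) / 2) * v x + fderiv ℝ v x x

noncomputable def LamC {N : ℕ} (v : Rn N → ℂ) (x : Rn N) : ℂ :=
  ((((N : ℝ) - 4) / 2) : ℝ) * v x + fderiv ℝ v x x

noncomputable def rescR {N : ℕ} (lam : ℝ) (u : Rn N → ℝ) (x : Rn N) : ℝ :=
  lam ^ (-(((N : ℝ) - 4) / 2)) * u (lam⁻¹ • x)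

noncomputable def fNL (N : ℕ) (z : ℂ) : ℂ :=
  Complex.ofReal (‖z‖ ^ ((8 : ℝ) / ((N : ℝ) - 4))) * z

noncomputable def fNL' (N : ℕ) (z w : ℂ) : ℂ :=
  if z = 0 then 0 else
    Complex.ofReal (‖z‖ ^ ((8 : ℝ) / ((N : ℝ) - 4))) *
      (w + Complex.ofReal (((8 : ℝ) / ((N : ℝ) - 4)) * ((((starRingEnd ℂ) z) * w).re / ‖z‖ ^ 2)) * z)

noncomputable def FNL (N : ℕ) (z : ℂ) : ℝ :=
  (((N : ℝ) - 4) / (2 * (N : ℝ))) * ‖z‖ ^ ((2 * (N : ℝ)) / ((N : ℝ) - 4))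

noncomputable def cexp (θ : ℝ) : ℂ := Complex.exp (Complex.I * θ)

noncomputable def pairC {N : ℕ} (v w : Rn N → ℂ) : ℝ :=
  ∫ x : Rn N, ((starRingEnd ℂ) (v x) * w x).re

noncomputable def energyC {N : ℕ} (u : Rn N → ℂ) : ℝ :=
  (1 / 2) * (∫ x : Rn N, ‖lapC u x‖ ^ 2) - (∫ x : Rn N, FNL N (u x))

noncomputable def enorm2 {N : ℕ} (g : Rn N → ℂ) : ℝ := ∫ x : Rn N, ‖lapC g x‖ ^ 2

namespace Rad
open Set Filter Topology

theorem pow_le_q (a b : ℕ) (h : a ≤ 2 * b) {r : ℝ} (hr : 0 < r) : r ^ a ≤ (1 + r ^ 2) ^ b := by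
  have h1 : (r ^ a) ^ 2 ≤ ((1 + r ^ 2) ^ b) ^ 2 := by
    calc (r ^ a) ^ 2 = (r ^ 2) ^ a := by ring
      _ ≤ (1 + r ^ 2) ^ a := by gcongr; linarith
      _ ≤ (1 + r ^ 2) ^ (2 * b) := by
        apply pow_le_pow_right₀ _ h
        nlinarith
      _ = _ := by ring
  exact le_of_sq_le_sq h1 (by positivity)
where le_of_sq_le_sq {a b : ℝ} (h : a ^ 2 ≤ b ^ 2) (hb : 0 ≤ b) : a ≤ b := abs_le_of_sq_le_sq' h hb |>.2

theorem wt_contOn (a b : ℕ) : ContinuousOn (fun r : ℝ => r ^ a / (1 + r ^ 2) ^ b) (Ioi 0) := by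
  apply Continuous.continuousOn
  apply Continuous.div (by fun_prop) (by fun_prop)
  intro x; positivity

theorem wt_integrable (a b : ℕ) (h : a + 2 ≤ 2 * b) :
    IntegrableOn (fun r : ℝ => r ^ a / (1 + r ^ 2) ^ b) (Ioi 0) := by
  refine Integrable.mono' (g := fun r : ℝ => (1 + r ^ 2)⁻¹) integrable_inv_one_add_sq.integrableOn
    ((wt_contOn a b).aestronglyMeasurable measurableSet_Ioi) ?_
  filter_upwards [ae_restrict_mem measurableSet_Ioi] with r hr
  have hr : 0 < r := hr
  rw [Real.norm_of_nonneg (by positivity)]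
  obtain ⟨c, rfl⟩ : ∃ c, b = c + 1 := ⟨b - 1, by omega⟩
  have := pow_le_q a c (by omega) hr
  rw [div_le_iff₀ (by positivity)]
  calc r ^ a ≤ (1 + r ^ 2) ^ c := this
    _ = _ := by field_simp; ring

theorem wt_bdd_integrable (a b : ℕ) (h : a + 2 ≤ 2 * b) {u : ℝ → ℝ} {K : ℝ}
    (hu : ContinuousOn u (Ioi 0)) (hK : ∀ r, 0 < r → |u r| ≤ K) :
    IntegrableOn (fun r : ℝ => u r * (r ^ a / (1 + r ^ 2) ^ b)) (Ioi 0) := by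
  refine Integrable.mono' (g := fun r : ℝ => K * (r ^ a / (1 + r ^ 2) ^ b))
    ((wt_integrable a b h).const_mul K)
    ((hu.mul (wt_contOn a b)).aestronglyMeasurable measurableSet_Ioi) ?_
  filter_upwards [ae_restrict_mem measurableSet_Ioi] with r hr
  have hr : 0 < r := hr
  rw [norm_mul, Real.norm_of_nonneg (by positivity : (0:ℝ) ≤ r ^ a / (1 + r ^ 2) ^ b), Real.norm_eq_abs]
  gcongr
  exact hK r hr

theorem wt_tendsto_zero (a b : ℕ) (h : 1 ≤ a) {u : ℝ → ℝ} {K : ℝ}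
    (hK : ∀ r, 0 < r → |u r| ≤ K) :
    Tendsto (fun r : ℝ => u r * (r ^ a / (1 + r ^ 2) ^ b)) (𝓝[>] 0) (𝓝 0) := by
  have h1 : Tendsto (fun r : ℝ => K * (r ^ a / (1 + r ^ 2) ^ b)) (𝓝[>] 0) (𝓝 0) := by
    have : Continuous (fun r : ℝ => K * (r ^ a / (1 + r ^ 2) ^ b)) := by
      apply Continuous.mul (by fun_prop)
      apply Continuous.div (by fun_prop) (by fun_prop)
      intro x; positivity
    have h2 := this.tendsto 0
    simp only [zero_pow (by omega : a ≠ 0), zero_div, mul_zero] at h2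
    exact h2.mono_left nhdsWithin_le_nhds
  refine squeeze_zero_norm' ?_ h1
  filter_upwards [self_mem_nhdsWithin] with r hr
  have hr : 0 < r := hr
  rw [norm_mul, Real.norm_of_nonneg (by positivity : (0:ℝ) ≤ r ^ a / (1 + r ^ 2) ^ b), Real.norm_eq_abs]
  gcongr
  exact hK r hr

theorem wt_tendsto_top (a b : ℕ) (h : a + 1 ≤ 2 * b) {u : ℝ → ℝ} {K : ℝ}
    (hK : ∀ r, 0 < r → |u r| ≤ K) :
    Tendsto (fun r : ℝ => u r * (r ^ a / (1 + r ^ 2) ^ b)) atTop (𝓝 0) := by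
  have h1 : Tendsto (fun r : ℝ => K * r⁻¹) atTop (𝓝 0) := by
    simpa using tendsto_inv_atTop_zero.const_mul K
  refine squeeze_zero_norm' ?_ h1
  filter_upwards [eventually_gt_atTop 0] with r hr
  rw [norm_mul, Real.norm_of_nonneg (by positivity : (0:ℝ) ≤ r ^ a / (1 + r ^ 2) ^ b), Real.norm_eq_abs]
  have h2 : r ^ a / (1 + r ^ 2) ^ b ≤ r⁻¹ := by
    rw [div_le_iff₀ (by positivity), inv_mul_eq_div, le_div_iff₀ hr]
    simpa [pow_succ] using pow_le_q (a + 1) b h hr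
  have h3 := hK r hr
  have h4 : 0 ≤ K := (abs_nonneg _).trans h3
  gcongr

/-- FTC on the half line with vanishing boundary values -/
theorem ftc_zero {B B' : ℝ → ℝ} (hB : ∀ r, 0 < r → HasDerivAt B (B' r) r)
    (hi : IntegrableOn B' (Ioi 0)) (h0 : Tendsto B (𝓝[>] 0) (𝓝 0))
    (h1 : Tendsto B atTop (𝓝 0)) : ∫ r in Ioi (0:ℝ), B' r = 0 := by
  have := integral_Ioi_deriv_mul_eq_sub (a := (0:ℝ)) (u := B) (v := fun _ => (1:ℝ)) (u' := B')
    (v' := fun _ => (0:ℝ)) (a' := (0:ℝ)) (b' := (0:ℝ)) (fun x hx => hB x hx) (fun x _ => hasDerivAt_const x 1)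
    (by refine hi.congr_fun ?_ measurableSet_Ioi; intro x _; simp)
    (by refine h0.congr ?_; intro x; simp) (by refine h1.congr ?_; intro x; simp)
  simpa using this

theorem ftc_le {B B' f : ℝ → ℝ} (hB : ∀ r, 0 < r → HasDerivAt B (B' r) r)
    (hle : ∀ r, 0 < r → B' r ≤ f r)
    (hi : IntegrableOn f (Ioi 0)) (h0 : Tendsto B (𝓝[>] 0) (𝓝 0))
    (h1 : Tendsto B atTop (𝓝 0)) : 0 ≤ ∫ r in Ioi (0:ℝ), f r := by
  have hc0 : Tendsto (fun n : ℕ => (1 : ℝ) / ((n:ℝ) + 1)) atTop (𝓝 0) := tendsto_one_div_add_atTop_nhds_zero_nat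
  have hc1 : Tendsto (fun n : ℕ => (n:ℝ) + 1) atTop atTop :=
    tendsto_atTop_add_const_right _ _ tendsto_natCast_atTop_atTop
  have hcov := (aecover_Ioi_of_Ioi (μ := (volume : Measure ℝ)) hc0).inter (aecover_Iic hc1)
  have hlim := hcov.integral_tendsto_of_countably_generated hi
  have hc0' : Tendsto (fun n : ℕ => (1 : ℝ) / ((n:ℝ) + 1)) atTop (𝓝[>] 0) := by
    rw [tendsto_nhdsWithin_iff]
    exact ⟨hc0, Eventually.of_forall fun n => by simp only [mem_Ioi]; positivity⟩
  have hBlim := (h1.comp hc1).sub (h0.comp hc0')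
  simp only [sub_zero] at hBlim
  refine le_of_tendsto_of_tendsto hBlim hlim (Eventually.of_forall fun n => ?_)
  have hpos : (0:ℝ) < 1 / ((n:ℝ) + 1) := by positivity
  have hle1 : (1:ℝ) / ((n:ℝ) + 1) ≤ (n:ℝ) + 1 := by
    rw [div_le_iff₀ (by positivity)]; nlinarith [(Nat.cast_nonneg n : (0:ℝ) ≤ n)]
  have := intervalIntegral.sub_le_integral_of_hasDeriv_right_of_le hle1
    (g := B) (g' := B') (φ := f)
    (fun x hx => (hB x (hpos.trans_le hx.1)).continuousAt.continuousWithinAt)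
    (fun x hx => (hB x (hpos.trans hx.1)).hasDerivWithinAt)
    (hi.mono_set (fun x hx => hpos.trans_le hx.1))
    (fun x hx => hle x (hpos.trans hx.1))
  rw [intervalIntegral.integral_of_le hle1] at this
  beta_reduce
  rw [Ioi_inter_Iic, Measure.restrict_restrict measurableSet_Ioc]
  have hsub : Ioc (1 / ((n:ℝ) + 1)) ((n:ℝ) + 1) ⊆ Ioi 0 := fun x hx => hpos.trans hx.1
  rw [inter_eq_self_of_subset_left hsub]
  exact this

/-- Cauchy-Schwarz -/
theorem cs {P Q R : ℝ → ℝ} {μ : Measure ℝ} (hP : Integrable P μ)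
    (hQ : Integrable Q μ) (hR : Integrable R μ)
    (h : ∀ s : ℝ, ∀ᵐ r ∂μ, 0 ≤ Q r * (s * s) + 2 * R r * s + P r) :
    (∫ r, R r ∂μ) ^ 2 ≤ (∫ r, P r ∂μ) * ∫ r, Q r ∂μ := by
  have key : ∀ s : ℝ, 0 ≤ (∫ r, Q r ∂μ) * (s * s) + (2 * ∫ r, R r ∂μ) * s + ∫ r, P r ∂μ := by
    intro s
    have : (∫ r, Q r ∂μ) * (s * s) + (2 * ∫ r, R r ∂μ) * s + ∫ r, P r ∂μ
        = ∫ r, (Q r * (s * s) + 2 * R r * s + P r) ∂μ := by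
      have e1 : Integrable (fun r => Q r * (s * s)) μ := hQ.mul_const _
      have e2 : Integrable (fun r => 2 * R r * s) μ := (hR.const_mul 2).mul_const _
      have e3 : Integrable (fun r => Q r * (s * s) + 2 * R r * s) μ := e1.add e2
      rw [integral_add e3 hP, integral_add e1 e2, integral_mul_const, integral_mul_const, integral_const_mul]
    rw [this]
    exact integral_nonneg_of_ae (h s)
  have := discrim_le_zero key
  unfold discrim at this
  nlinarith

end Rad

namespace Rad
open Set Filter Topology

theorem poincare0 (j : ℕ) {u v : ℝ → ℝ} {K : ℝ}
    (hu : ∀ r, 0 < r → HasDerivAt u (v r) r) (hK : ∀ r, 0 < r → |u r| ≤ K)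
    (hvi : IntegrableOn (fun r : ℝ => v r ^ 2 * ((1 + r ^ 2) ^ 2 / 4) * (r ^ (j + 1) / (1 + r ^ 2) ^ (j + 2))) (Ioi 0))
    (hmean : ∫ r in Ioi (0:ℝ), u r * (r ^ (j + 1) / (1 + r ^ 2) ^ (j + 2)) = 0) :
    ((j:ℝ) + 2) * ∫ r in Ioi (0:ℝ), u r ^ 2 * (r ^ (j + 1) / (1 + r ^ 2) ^ (j + 2)) ≤
      ∫ r in Ioi (0:ℝ), v r ^ 2 * ((1 + r ^ 2) ^ 2 / 4) * (r ^ (j + 1) / (1 + r ^ 2) ^ (j + 2)) := by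
  have hucont : ContinuousOn u (Ioi 0) := fun r hr => (hu r hr).continuousAt.continuousWithinAt
  have hK0 : 0 ≤ K := (abs_nonneg _).trans (hK 1 one_pos)
  set w : ℝ → ℝ := fun r => r ^ (j + 1) / (1 + r ^ 2) ^ (j + 2) with hw
  have hui : IntegrableOn (fun r => u r * w r) (Ioi 0) :=
    wt_bdd_integrable (j + 1) (j + 2) (by omega) hucont hK
  have hu2i : IntegrableOn (fun r => u r ^ 2 * w r) (Ioi 0) :=
    wt_bdd_integrable (K := K ^ 2) (j + 1) (j + 2) (by omega) (hucont.pow 2) (by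
      intro r hr; rw [abs_pow]; gcongr; exact hK r hr)
  set F : ℝ → ℝ := fun r => ∫ s in (0:ℝ)..r, u s * w s with hF
  have hFd : ∀ r, 0 < r → HasDerivAt F (u r * w r) r := by
    intro r hr
    have hcw : ContinuousOn (fun s => u s * w s) (Ioi 0) := hucont.mul (wt_contOn _ _)
    refine intervalIntegral.integral_hasDerivAt_right ?_ ?_ (hcw.continuousAt (Ioi_mem_nhds hr))
    · rw [intervalIntegrable_iff_integrableOn_Ioc_of_le hr.le]
      exact hui.mono_set Ioc_subset_Ioi_self
    · exact hcw.stronglyMeasurableAtFilter isOpen_Ioi r hr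
  have hwle1 : ∀ s, 0 < s → |w s| ≤ s ^ (j + 1) := by
    intro s hs
    rw [abs_of_nonneg (by positivity)]
    refine div_le_self (by positivity) ?_
    apply one_le_pow₀; nlinarith
  have hF1 : ∀ r, 0 < r → |F r| ≤ K * r ^ (j + 2) := by
    intro r hr
    have := intervalIntegral.norm_integral_le_of_norm_le_const (a := (0:ℝ)) (b := r) (C := K * r ^ (j + 1))
      (f := fun s => u s * w s) (by
        intro s hs
        rw [uIoc_of_le hr.le] at hs
        rw [norm_mul, Real.norm_eq_abs, Real.norm_eq_abs]
        refine mul_le_mul (hK s hs.1) ((hwle1 s hs.1).trans ?_) (abs_nonneg _) hK0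
        exact pow_le_pow_left₀ hs.1.le hs.2 _)
    rw [sub_zero, abs_of_pos hr, Real.norm_eq_abs] at this
    calc |F r| ≤ _ := this
      _ = _ := by ring
  have hF2 : ∀ r, 0 < r → |F r| ≤ K / r ^ (j + 2) := by
    intro r hr
    have hFr : F r = - ∫ s in Ioi r, u s * w s := by
      have h1 : (∫ s in Ioi (0:ℝ), u s * w s) = (∫ s in Ioc 0 r, u s * w s) + ∫ s in Ioi r, u s * w s := by
        rw [← setIntegral_union (by
          rw [Set.disjoint_left]; intro x hx hx'; exact absurd hx.2 (not_le.2 hx')) measurableSet_Ioi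
          (hui.mono_set Ioc_subset_Ioi_self) (hui.mono_set (Ioi_subset_Ioi hr.le)), Ioc_union_Ioi_eq_Ioi hr.le]
      rw [hmean] at h1
      simp only [hF]
      rw [intervalIntegral.integral_of_le hr.le]
      linarith
    have hint : IntegrableOn (fun s : ℝ => s ^ (-2:ℝ)) (Ioi r) := integrableOn_Ioi_rpow_of_lt (by norm_num) hr
    have hval : ∫ s in Ioi r, s ^ (-2:ℝ) = r⁻¹ := by
      rw [integral_Ioi_rpow_of_lt (by norm_num) hr]
      norm_num
      rw [Real.rpow_neg hr.le, Real.rpow_one]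
    have hb : ‖∫ s in Ioi r, u s * w s‖ ≤ ∫ s in Ioi r, (K / r ^ (j + 1)) * s ^ (-2:ℝ) := by
      refine norm_integral_le_of_norm_le (hint.const_mul _) ?_
      filter_upwards [ae_restrict_mem measurableSet_Ioi] with s hs
      have hs : r < s := hs
      have hs0 : 0 < s := hr.trans hs
      rw [norm_mul, Real.norm_eq_abs, Real.norm_eq_abs, Real.rpow_neg hs0.le]
      have : |w s| ≤ 1 / r ^ (j + 1) * (s ^ (2:ℝ))⁻¹ := by
        rw [abs_of_nonneg (by positivity)]
        norm_cast
        have e1 : s ^ (j + 1) / (1 + s ^ 2) ^ (j + 2) ≤ s ^ (j + 1) / (s ^ 2) ^ (j + 2) := by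
          gcongr; linarith
        have e2 : s ^ (j + 1) / (s ^ 2) ^ (j + 2) = 1 / s ^ (j + 1) * (s ^ 2)⁻¹ := by
          field_simp; ring
        refine (e1.trans_eq e2).trans ?_
        gcongr
      calc |u s| * |w s| ≤ K * (1 / r ^ (j + 1) * (s ^ (2:ℝ))⁻¹) := by
            gcongr
            exact hK s hs0
        _ = _ := by ring
    rw [integral_const_mul, hval, Real.norm_eq_abs] at hb
    rw [hFr, abs_neg]
    calc _ ≤ _ := hb
      _ = _ := by field_simp; try ring
  set M : ℝ := (j:ℝ) + 2 with hM
  -- the boundary function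
  set B : ℝ → ℝ := fun r => -2 * M * (u r * F r) + M ^ 2 * ((1 - r ^ 2) * F r ^ 2 * (1 + r ^ 2) ^ (j + 1) / r ^ (j + 2)) with hB
  have hBd : ∀ r, 0 < r → HasDerivAt B (-2 * M * (v r * F r + u r * (u r * w r)) +
      M ^ 2 * (((((-(2 * r)) * F r ^ 2 + (1 - r ^ 2) * (2 * F r * (u r * w r))) * (1 + r ^ 2) ^ (j + 1)
        + (1 - r ^ 2) * F r ^ 2 * ((j + 1) * (1 + r ^ 2) ^ j * (2 * r))) * r ^ (j + 2)
        - ((1 - r ^ 2) * F r ^ 2 * (1 + r ^ 2) ^ (j + 1)) * ((j + 2) * r ^ (j + 1))) / (r ^ (j + 2)) ^ 2)) r := by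
    intro r hr
    have d1 : HasDerivAt (fun r : ℝ => 1 - r ^ 2) (-(2 * r)) r := by
      simpa using (hasDerivAt_pow 2 r).const_sub 1
    have d2 : HasDerivAt (fun r : ℝ => (1 + r ^ 2) ^ (j + 1)) ((j + 1) * (1 + r ^ 2) ^ j * (2 * r)) r := by
      have := ((hasDerivAt_pow 2 r).const_add 1).fun_pow (j + 1)
      simpa using this
    have d3 : HasDerivAt (fun r : ℝ => r ^ (j + 2)) ((j + 2) * r ^ (j + 1)) r := by
      have := hasDerivAt_pow (j + 2) r
      simpa using this
    have d4 : HasDerivAt (fun r : ℝ => F r ^ 2) (2 * F r * (u r * w r)) r := by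
      have := (hFd r hr).fun_pow 2
      simpa using this
    exact (((hu r hr).mul (hFd r hr)).const_mul (-2 * M)).add
      ((((d1.mul d4).mul d2).div d3 (by positivity)).const_mul (M ^ 2))
  have hfi : IntegrableOn (fun r => v r ^ 2 * ((1 + r ^ 2) ^ 2 / 4) * w r - M * (u r ^ 2 * w r)) (Ioi 0) :=
    hvi.sub (hu2i.const_mul M)
  have hle := ftc_le hBd (f := fun r => v r ^ 2 * ((1 + r ^ 2) ^ 2 / 4) * w r - M * (u r ^ 2 * w r)) ?_ hfi ?_ ?_
  · rw [integral_sub hvi (hu2i.const_mul M), integral_const_mul] at hle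
    linarith
  · intro r hr
    have hr' : r ≠ 0 := hr.ne'
    have hM0 : 0 < M := by positivity
    rw [← sub_nonneg]
    have key : ∀ x U f : ℝ, x ^ 2 * ((1 + r ^ 2) ^ 2 / 4) * w r - M * (U ^ 2 * w r) - (-2 * M * (x * f + U * (U * w r)) +
      M ^ 2 * (((((-(2 * r)) * f ^ 2 + (1 - r ^ 2) * (2 * f * (U * w r))) * (1 + r ^ 2) ^ (j + 1)
        + (1 - r ^ 2) * f ^ 2 * ((j + 1) * (1 + r ^ 2) ^ j * (2 * r))) * r ^ (j + 2)
        - ((1 - r ^ 2) * f ^ 2 * (1 + r ^ 2) ^ (j + 1)) * ((j + 2) * r ^ (j + 1))) / (r ^ (j + 2)) ^ 2))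
       = ((1 + r ^ 2) ^ 2 / 4) * w r * (x + M * f / (((1 + r ^ 2) ^ 2 / 4) * w r)) ^ 2
         + M * (1 / w r) * (U * w r - M * ((1 - r ^ 2) / (1 + r ^ 2)) * f / r) ^ 2 := by
      intro x U f
      simp only [hw, hM]
      have hq : (1 + r ^ 2) ≠ 0 := by positivity
      have hp : r ^ j ≠ 0 := by positivity
      have hQ : (1 + r ^ 2) ^ j ≠ 0 := by positivity
      simp only [pow_succ (n := j), pow_succ (n := j + 1)]
      generalize r ^ j = p at *
      generalize (1 + r ^ 2) ^ j = Q at *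
      field_simp
      ring
    rw [key]
    have hwp : 0 < w r := by simp only [hw]; positivity
    positivity
  · have hz : Tendsto (fun r : ℝ => 2 * M * (K * (K * r ^ (j + 2))) + M ^ 2 * ((1 + r ^ 2) * K ^ 2 * r ^ (j + 2) * (1 + r ^ 2) ^ (j + 1))) (𝓝[>] 0) (𝓝 0) := by
      have hc : Continuous (fun r : ℝ => 2 * M * (K * (K * r ^ (j + 2))) + M ^ 2 * ((1 + r ^ 2) * K ^ 2 * r ^ (j + 2) * (1 + r ^ 2) ^ (j + 1))) := by fun_prop
      have := hc.tendsto 0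
      simp at this
      exact this.mono_left nhdsWithin_le_nhds
    refine squeeze_zero_norm' ?_ hz
    filter_upwards [self_mem_nhdsWithin] with r hr
    have hr : 0 < r := hr
    have h1 := hF1 r hr
    have h2 : F r ^ 2 ≤ (K * r ^ (j + 2)) ^ 2 := by rw [← sq_abs]; gcongr
    have h3 : |1 - r ^ 2| ≤ 1 + r ^ 2 := by rw [abs_le]; constructor <;> nlinarith
    refine (norm_add_le _ _).trans ?_
    have e1 : ‖-2 * M * (u r * F r)‖ = 2 * M * (|u r| * |F r|) := by
      simp [abs_mul, abs_of_nonneg (by positivity : (0:ℝ) ≤ M)]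
    have e2 : ‖M ^ 2 * ((1 - r ^ 2) * F r ^ 2 * (1 + r ^ 2) ^ (j + 1) / r ^ (j + 2))‖ =
      M ^ 2 * (|1 - r ^ 2| * F r ^ 2 * (1 + r ^ 2) ^ (j + 1) / r ^ (j + 2)) := by
      rw [Real.norm_eq_abs, abs_mul, abs_div, abs_mul, abs_mul, abs_of_nonneg (by positivity : (0:ℝ) ≤ M ^ 2),
        abs_of_nonneg (by positivity : (0:ℝ) ≤ r ^ (j + 2)), abs_of_nonneg (sq_nonneg (F r)),
        abs_of_nonneg (by positivity : (0:ℝ) ≤ (1 + r ^ 2) ^ (j + 1))]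
    rw [e1, e2]
    gcongr
    · exact hK r hr
    · calc |1 - r ^ 2| * F r ^ 2 * (1 + r ^ 2) ^ (j + 1) / r ^ (j + 2) ≤
          (1 + r ^ 2) * (K * r ^ (j + 2)) ^ 2 * (1 + r ^ 2) ^ (j + 1) / r ^ (j + 2) := by gcongr
        _ = _ := by field_simp
  · have hz : Tendsto (fun r : ℝ => (2 * M * K ^ 2 + M ^ 2 * (2 ^ (j + 2) * K ^ 2)) * r⁻¹) atTop (𝓝 0) := by
      have h := (tendsto_inv_atTop_zero (𝕜 := ℝ)).const_mul (2 * M * K ^ 2 + M ^ 2 * (2 ^ (j + 2) * K ^ 2))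
      rw [mul_zero] at h
      exact h
    refine squeeze_zero_norm' ?_ hz
    filter_upwards [eventually_ge_atTop 1] with r hr1
    have hr : 0 < r := by linarith
    have h1 := hF2 r hr
    have h2 : F r ^ 2 ≤ (K / r ^ (j + 2)) ^ 2 := by rw [← sq_abs]; gcongr
    have h3 : |1 - r ^ 2| ≤ 1 + r ^ 2 := by rw [abs_le]; constructor <;> nlinarith
    have h4 : 1 + r ^ 2 ≤ 2 * r ^ 2 := by nlinarith
    have h5 : (r ^ (j + 2))⁻¹ ≤ r⁻¹ := by
      gcongr
      exact le_self_pow₀ hr1 (by omega)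
    refine (norm_add_le _ _).trans ?_
    have e1 : ‖-2 * M * (u r * F r)‖ = 2 * M * (|u r| * |F r|) := by
      simp [abs_mul, abs_of_nonneg (by positivity : (0:ℝ) ≤ M)]
    have e2 : ‖M ^ 2 * ((1 - r ^ 2) * F r ^ 2 * (1 + r ^ 2) ^ (j + 1) / r ^ (j + 2))‖ =
      M ^ 2 * (|1 - r ^ 2| * F r ^ 2 * (1 + r ^ 2) ^ (j + 1) / r ^ (j + 2)) := by
      rw [Real.norm_eq_abs, abs_mul, abs_div, abs_mul, abs_mul, abs_of_nonneg (by positivity : (0:ℝ) ≤ M ^ 2),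
        abs_of_nonneg (by positivity : (0:ℝ) ≤ r ^ (j + 2)), abs_of_nonneg (sq_nonneg (F r)),
        abs_of_nonneg (by positivity : (0:ℝ) ≤ (1 + r ^ 2) ^ (j + 1))]
    rw [e1, e2, add_mul]
    apply add_le_add
    · calc 2 * M * (|u r| * |F r|) ≤ 2 * M * (K * (K / r ^ (j + 2))) := by
            gcongr
            exact hK r hr
        _ = 2 * M * K ^ 2 * (r ^ (j + 2))⁻¹ := by field_simp
        _ ≤ _ := by gcongr
    · calc M ^ 2 * (|1 - r ^ 2| * F r ^ 2 * (1 + r ^ 2) ^ (j + 1) / r ^ (j + 2)) ≤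
          M ^ 2 * ((2 * r ^ 2) * (K / r ^ (j + 2)) ^ 2 * (2 * r ^ 2) ^ (j + 1) / r ^ (j + 2)) := by
            gcongr
            exact h3.trans h4
        _ = M ^ 2 * (2 ^ (j + 2) * K ^ 2) * (r ^ (j + 2))⁻¹ := by
            rw [mul_pow]
            field_simp
            ring
        _ ≤ _ := by gcongr

end Rad

namespace Rad
open Set Filter Topology

theorem wt_pos (a b : ℕ) (h : a + 2 ≤ 2 * b) :
    0 < ∫ r in Ioi (0:ℝ), r ^ a / (1 + r ^ 2) ^ b := by
  rw [setIntegral_pos_iff_support_of_nonneg_ae]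
  · have : Function.support (fun r : ℝ => r ^ a / (1 + r ^ 2) ^ b) ∩ Ioi 0 = Ioi 0 := by
      ext r
      simp only [mem_inter_iff, Function.mem_support, mem_Ioi, and_iff_right_iff_imp]
      intro hr; positivity
    rw [this]; simp
  · filter_upwards [ae_restrict_mem measurableSet_Ioi] with r hr
    have hr : 0 < r := hr
    simp only [Pi.zero_apply]; positivity
  · exact wt_integrable a b h

theorem sq_bd {K : ℝ} {u : ℝ → ℝ} (h : ∀ r, 0 < r → |u r| ≤ K) : ∀ r, 0 < r → |u r ^ 2| ≤ K ^ 2 := by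
  intro r hr; rw [abs_pow]; gcongr; exact h r hr

theorem poincare (j : ℕ) {u v : ℝ → ℝ} {K : ℝ}
    (hu : ∀ r, 0 < r → HasDerivAt u (v r) r) (hK : ∀ r, 0 < r → |u r| ≤ K)
    (hvi : IntegrableOn (fun r : ℝ => v r ^ 2 * ((1 + r ^ 2) ^ 2 / 4) * (r ^ (j + 1) / (1 + r ^ 2) ^ (j + 2))) (Ioi 0)) :
    ((j:ℝ) + 2) * ((∫ r in Ioi (0:ℝ), u r ^ 2 * (r ^ (j + 1) / (1 + r ^ 2) ^ (j + 2)))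
        - (∫ r in Ioi (0:ℝ), u r * (r ^ (j + 1) / (1 + r ^ 2) ^ (j + 2))) ^ 2
          / (∫ r in Ioi (0:ℝ), r ^ (j + 1) / (1 + r ^ 2) ^ (j + 2))) ≤
      ∫ r in Ioi (0:ℝ), v r ^ 2 * ((1 + r ^ 2) ^ 2 / 4) * (r ^ (j + 1) / (1 + r ^ 2) ^ (j + 2)) := by
  have hucont : ContinuousOn u (Ioi 0) := fun r hr => (hu r hr).continuousAt.continuousWithinAt
  have hui := wt_bdd_integrable (j + 1) (j + 2) (by omega) hucont hK
  have hu2i := wt_bdd_integrable (K := K ^ 2) (j + 1) (j + 2) (by omega) (hucont.pow 2) (sq_bd hK)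
  have hZp := wt_pos (j + 1) (j + 2) (by omega)
  have hwi := wt_integrable (j + 1) (j + 2) (by omega)
  set w : ℝ → ℝ := fun r => r ^ (j + 1) / (1 + r ^ 2) ^ (j + 2) with hw
  change IntegrableOn (fun r => u r * w r) _ at hui
  change IntegrableOn (fun r => u r ^ 2 * w r) _ at hu2i
  set Z := ∫ r in Ioi (0:ℝ), w r with hZ
  set A := ∫ r in Ioi (0:ℝ), u r * w r with hA
  have hZ0 : Z ≠ 0 := hZp.ne'
  have h := poincare0 j (u := fun r => u r - A / Z) (v := v) (K := K + |A / Z|)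
    (fun r hr => (hu r hr).sub_const _)
    (fun r hr => (abs_sub _ _).trans (by gcongr; exact hK r hr)) hvi (by
      change ∫ r in Ioi (0:ℝ), (u r - A / Z) * w r = 0
      simp only [sub_mul]
      rw [integral_sub hui (hwi.const_mul _), integral_const_mul, ← hZ, ← hA]
      field_simp; ring)
  change ((j:ℝ) + 2) * ∫ r in Ioi (0:ℝ), (u r - A / Z) ^ 2 * w r ≤ _ at h
  have e : ∫ r in Ioi (0:ℝ), (u r - A / Z) ^ 2 * w r = (∫ r in Ioi (0:ℝ), u r ^ 2 * w r) - A ^ 2 / Z := by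
    have e0 : ∀ r, (u r - A / Z) ^ 2 * w r = u r ^ 2 * w r - (2 * (A / Z)) * (u r * w r) + (A / Z) ^ 2 * w r := by
      intro r; ring
    simp only [e0]
    rw [integral_add (by exact hu2i.sub (hui.const_mul _)) (hwi.const_mul _), integral_sub hu2i (hui.const_mul _),
      integral_const_mul, integral_const_mul, ← hA, ← hZ]
    field_simp; ring
  rw [e] at h
  exact h

structure Tri (φ ψ χ : ℝ → ℝ) (K : ℝ) : Prop where
  dφ : ∀ r, 0 < r → HasDerivAt φ (4 * r * ψ r / (1 + r ^ 2) ^ 2) r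
  dψ : ∀ r, 0 < r → HasDerivAt ψ (χ r / r) r
  cχ : ContinuousOn χ (Ioi 0)
  bφ : ∀ r, 0 < r → |φ r| ≤ K
  bψ : ∀ r, 0 < r → |ψ r| ≤ K
  bχ : ∀ r, 0 < r → |χ r| ≤ K

section
variable {φ ψ χ : ℝ → ℝ} {K : ℝ}
theorem Tri.cφ (h : Tri φ ψ χ K) : ContinuousOn φ (Ioi 0) := fun r hr => (h.dφ r hr).continuousAt.continuousWithinAt
theorem Tri.cψ (h : Tri φ ψ χ K) : ContinuousOn ψ (Ioi 0) := fun r hr => (h.dψ r hr).continuousAt.continuousWithinAt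
variable (n : ℕ)
theorem Tri.iφ (h : Tri φ ψ χ K) : IntegrableOn (fun r => φ r ^ 2 * (r ^ (n + 12) / (1 + r ^ 2) ^ (n + 13))) (Ioi 0) :=
  wt_bdd_integrable _ _ (by omega) (h.cφ.pow 2) (sq_bd h.bφ)
theorem Tri.iψ (h : Tri φ ψ χ K) : IntegrableOn (fun r => ψ r ^ 2 * (r ^ (n + 14) / (1 + r ^ 2) ^ (n + 15))) (Ioi 0) :=
  wt_bdd_integrable _ _ (by omega) (h.cψ.pow 2) (sq_bd h.bψ)
theorem Tri.iχ (h : Tri φ ψ χ K) : IntegrableOn (fun r => χ r ^ 2 * (r ^ (n + 12) / (1 + r ^ 2) ^ (n + 13))) (Ioi 0) :=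
  wt_bdd_integrable _ _ (by omega) (h.cχ.pow 2) (sq_bd h.bχ)

theorem Tri.p1 (h : Tri φ ψ χ K) :
    ((n:ℝ) + 13) * ((∫ r in Ioi (0:ℝ), φ r ^ 2 * (r ^ (n + 12) / (1 + r ^ 2) ^ (n + 13)))
        - (∫ r in Ioi (0:ℝ), φ r * (r ^ (n + 12) / (1 + r ^ 2) ^ (n + 13))) ^ 2
          / (∫ r in Ioi (0:ℝ), r ^ (n + 12) / (1 + r ^ 2) ^ (n + 13))) ≤
      4 * ∫ r in Ioi (0:ℝ), ψ r ^ 2 * (r ^ (n + 14) / (1 + r ^ 2) ^ (n + 15)) := by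
  have e : ∀ r ∈ Ioi (0:ℝ), 4 * (ψ r ^ 2 * (r ^ (n + 14) / (1 + r ^ 2) ^ (n + 15))) =
      (4 * r * ψ r / (1 + r ^ 2) ^ 2) ^ 2 * ((1 + r ^ 2) ^ 2 / 4) * (r ^ (n + 11 + 1) / (1 + r ^ 2) ^ (n + 11 + 2)) := by
    intro r hr
    have hr : 0 < r := hr
    field_simp
    ring
  have h4 : IntegrableOn (fun r => 4 * (ψ r ^ 2 * (r ^ (n + 14) / (1 + r ^ 2) ^ (n + 15)))) (Ioi 0) := (h.iψ n).const_mul 4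
  have hh := poincare (n + 11) h.dφ h.bφ (h4.congr_fun e measurableSet_Ioi)
  rw [← setIntegral_congr_fun measurableSet_Ioi e, integral_const_mul] at hh
  push_cast at hh
  convert hh using 2
  ring

theorem Tri.p2 (h : Tri φ ψ χ K) :
    ((n:ℝ) + 15) * ((∫ r in Ioi (0:ℝ), ψ r ^ 2 * (r ^ (n + 14) / (1 + r ^ 2) ^ (n + 15)))
        - (∫ r in Ioi (0:ℝ), ψ r * (r ^ (n + 14) / (1 + r ^ 2) ^ (n + 15))) ^ 2
          / (∫ r in Ioi (0:ℝ), r ^ (n + 14) / (1 + r ^ 2) ^ (n + 15))) ≤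
      (1 / 4) * ∫ r in Ioi (0:ℝ), χ r ^ 2 * (r ^ (n + 12) / (1 + r ^ 2) ^ (n + 13)) := by
  have e : ∀ r ∈ Ioi (0:ℝ), (1 / 4) * (χ r ^ 2 * (r ^ (n + 12) / (1 + r ^ 2) ^ (n + 13))) =
      (χ r / r) ^ 2 * ((1 + r ^ 2) ^ 2 / 4) * (r ^ (n + 13 + 1) / (1 + r ^ 2) ^ (n + 13 + 2)) := by
    intro r hr
    have hr : 0 < r := hr
    field_simp
    ring
  have h4 : IntegrableOn (fun r => (1 / 4) * (χ r ^ 2 * (r ^ (n + 12) / (1 + r ^ 2) ^ (n + 13)))) (Ioi 0) := (h.iχ n).const_mul (1 / 4)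
  have hh := poincare (n + 13) h.dψ h.bψ (h4.congr_fun e measurableSet_Ioi)
  rw [← setIntegral_congr_fun measurableSet_Ioi e, integral_const_mul] at hh
  push_cast at hh
  convert hh using 2
  ring

theorem d_wt (a b : ℕ) {r : ℝ} (hr : 0 < r) : HasDerivAt (fun r : ℝ => r ^ (a + 1) / (1 + r ^ 2) ^ (b + 1))
    (((a:ℝ) + 1) * (r ^ a / (1 + r ^ 2) ^ (b + 1)) - 2 * ((b:ℝ) + 1) * (r ^ (a + 2) / (1 + r ^ 2) ^ (b + 2))) r := by
  have d2 : HasDerivAt (fun r : ℝ => (1 + r ^ 2) ^ (b + 1)) ((b + 1) * (1 + r ^ 2) ^ b * (2 * r)) r := by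
    have := ((hasDerivAt_pow 2 r).const_add 1).fun_pow (b + 1)
    simpa using this
  have d3 : HasDerivAt (fun r : ℝ => r ^ (a + 1)) ((a + 1) * r ^ a) r := by
    have := hasDerivAt_pow (a + 1) r
    simpa using this
  refine (d3.fun_div d2 (by positivity)).congr_deriv ?_
  field_simp
  ring

theorem Tri.ibp1 (h : Tri φ ψ χ K) :
    ((n:ℝ) + 5) * (∫ r in Ioi (0:ℝ), φ r * (r ^ (n + 12) / (1 + r ^ 2) ^ (n + 9))) =
      2 * ((n:ℝ) + 9) * (∫ r in Ioi (0:ℝ), φ r * (r ^ (n + 12) / (1 + r ^ 2) ^ (n + 10)))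
      + 4 * ∫ r in Ioi (0:ℝ), ψ r * (r ^ (n + 14) / (1 + r ^ 2) ^ (n + 11)) := by
  have i1 := wt_bdd_integrable (n + 12) (n + 9) (by omega) h.cφ h.bφ
  have i2 := wt_bdd_integrable (n + 12) (n + 10) (by omega) h.cφ h.bφ
  have i3 := wt_bdd_integrable (n + 14) (n + 11) (by omega) h.cψ h.bψ
  have i4 := ((i2.const_mul (2 * ((n:ℝ) + 9))).add (i3.const_mul 4)).sub (i1.const_mul ((n:ℝ) + 5))
  have := ftc_zero (B := fun r => φ r * (r ^ (n + 13) / (1 + r ^ 2) ^ (n + 9)))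
    (B' := fun r => (2 * ((n:ℝ) + 9) * (φ r * (r ^ (n + 12) / (1 + r ^ 2) ^ (n + 10)))
      + 4 * (ψ r * (r ^ (n + 14) / (1 + r ^ 2) ^ (n + 11)))) - ((n:ℝ) + 5) * (φ r * (r ^ (n + 12) / (1 + r ^ 2) ^ (n + 9))))
      (by
        intro r hr
        refine ((h.dφ r hr).fun_mul (d_wt (n + 12) (n + 8) hr)).congr_deriv ?_
        push_cast
        field_simp
        ring) (by exact i4) (wt_tendsto_zero _ _ (by omega) h.bφ) (wt_tendsto_top _ _ (by omega) h.bφ)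
  rw [integral_sub (by exact (i2.const_mul (2 * ((n:ℝ) + 9))).add (i3.const_mul 4)) (i1.const_mul ((n:ℝ) + 5)),
    integral_add (i2.const_mul (2 * ((n:ℝ) + 9))) (i3.const_mul 4), integral_const_mul, integral_const_mul,
    integral_const_mul] at this
  linarith

theorem Tri.ibp2 (h : Tri φ ψ χ K) :
    ((n:ℝ) + 7) * (∫ r in Ioi (0:ℝ), ψ r * (r ^ (n + 14) / (1 + r ^ 2) ^ (n + 11))) =
      2 * ((n:ℝ) + 11) * (∫ r in Ioi (0:ℝ), ψ r * (r ^ (n + 14) / (1 + r ^ 2) ^ (n + 12)))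
      + ∫ r in Ioi (0:ℝ), χ r * (r ^ (n + 14) / (1 + r ^ 2) ^ (n + 11)) := by
  have i1 := wt_bdd_integrable (n + 14) (n + 11) (by omega) h.cψ h.bψ
  have i2 := wt_bdd_integrable (n + 14) (n + 12) (by omega) h.cψ h.bψ
  have i3 := wt_bdd_integrable (n + 14) (n + 11) (by omega) h.cχ h.bχ
  have i4 := ((i2.const_mul (2 * ((n:ℝ) + 11))).add i3).sub (i1.const_mul ((n:ℝ) + 7))
  have := ftc_zero (B := fun r => ψ r * (r ^ (n + 15) / (1 + r ^ 2) ^ (n + 11)))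
    (B' := fun r => (2 * ((n:ℝ) + 11) * (ψ r * (r ^ (n + 14) / (1 + r ^ 2) ^ (n + 12)))
      + (χ r * (r ^ (n + 14) / (1 + r ^ 2) ^ (n + 11)))) - ((n:ℝ) + 7) * (ψ r * (r ^ (n + 14) / (1 + r ^ 2) ^ (n + 11))))
      (by
        intro r hr
        refine ((h.dψ r hr).fun_mul (d_wt (n + 14) (n + 10) hr)).congr_deriv ?_
        push_cast
        field_simp
        ring) (by exact i4) (wt_tendsto_zero _ _ (by omega) h.bψ) (wt_tendsto_top _ _ (by omega) h.bψ)
  rw [integral_sub (by exact (i2.const_mul (2 * ((n:ℝ) + 11))).add i3) (i1.const_mul ((n:ℝ) + 7)),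
    integral_add (i2.const_mul (2 * ((n:ℝ) + 11))) i3, integral_const_mul,
    integral_const_mul] at this
  linarith

theorem csw {u : ℝ → ℝ} {K : ℝ} (hu : ContinuousOn u (Ioi 0)) (hK : ∀ r, 0 < r → |u r| ≤ K)
    (a b a1 b1 a2 b2 : ℕ) (h : a + 2 ≤ 2 * b) (h1 : a1 + 2 ≤ 2 * b1) (h2 : a2 + 2 ≤ 2 * b2)
    (ha : a1 + a2 = 2 * a) (hb : b1 + b2 = 2 * b) :
    (∫ r in Ioi (0:ℝ), u r * (r ^ a / (1 + r ^ 2) ^ b)) ^ 2 ≤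
      (∫ r in Ioi (0:ℝ), u r ^ 2 * (r ^ a1 / (1 + r ^ 2) ^ b1)) *
        ∫ r in Ioi (0:ℝ), r ^ a2 / (1 + r ^ 2) ^ b2 := by
  refine cs (wt_bdd_integrable a1 b1 h1 (hu.pow 2) (sq_bd hK)) (wt_integrable a2 b2 h2)
    (wt_bdd_integrable a b h hu hK) ?_
  intro s
  filter_upwards [ae_restrict_mem measurableSet_Ioi] with r hr
  have hr : 0 < r := hr
  have e1 : (r ^ a1 / (1 + r ^ 2) ^ b1) * (r ^ a2 / (1 + r ^ 2) ^ b2) = (r ^ a / (1 + r ^ 2) ^ b) ^ 2 := by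
    rw [div_mul_div_comm, ← pow_add, ← pow_add, ha, hb, div_pow, pow_mul', pow_mul']
  have p1 : 0 < r ^ a1 / (1 + r ^ 2) ^ b1 := by positivity
  generalize r ^ a1 / (1 + r ^ 2) ^ b1 = x at *
  generalize r ^ a2 / (1 + r ^ 2) ^ b2 = y at *
  generalize r ^ a / (1 + r ^ 2) ^ b = z at *
  have e2 : y * (s * s) + 2 * (u r * z) * s + u r ^ 2 * x = (z * s + u r * x) ^ 2 / x := by
    field_simp
    linear_combination (s^2) * e1
  rw [e2]; positivity
end

end Rad

namespace Rad
open Set Filter Topology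

/-- weighted integral -/
def M (a b : ℕ) (u : ℝ → ℝ) : ℝ := ∫ r in Ioi (0:ℝ), u r * (r ^ a / (1 + r ^ 2) ^ b)

/-- weighted mass -/
def Zm (a b : ℕ) : ℝ := ∫ r in Ioi (0:ℝ), r ^ a / (1 + r ^ 2) ^ b

section
variable {φ ψ χ : ℝ → ℝ} {K : ℝ} (n : ℕ)

theorem M_nonneg (a b : ℕ) (u : ℝ → ℝ) : 0 ≤ M a b (fun r => u r ^ 2) := by
  refine setIntegral_nonneg measurableSet_Ioi ?_
  intro r hr
  have hr : 0 < r := hr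
  positivity

theorem ell_bd : ∃ C : ℝ, 0 < C ∧ ∀ {φ ψ χ : ℝ → ℝ} {K : ℝ}, Tri φ ψ χ K →
    M (n + 12) (n + 9) φ ^ 2 ≤ C * (M (n + 12) (n + 13) (fun r => φ r ^ 2)
      + M (n + 14) (n + 15) (fun r => ψ r ^ 2) + M (n + 12) (n + 13) (fun r => χ r ^ 2)) := by
  have z1 : 0 < Zm (n + 12) (n + 7) := wt_pos _ _ (by omega)
  have z2 : 0 < Zm (n + 14) (n + 9) := wt_pos _ _ (by omega)
  have z3 : 0 < Zm (n + 16) (n + 9) := wt_pos _ _ (by omega)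
  set α : ℝ := 2 * (n + 9) / (n + 5)
  set β : ℝ := 4 * (2 * (n + 11)) / ((n + 5) * (n + 7))
  set γ : ℝ := 4 / ((n + 5) * (n + 7))
  refine ⟨3 * (α ^ 2 * Zm (n + 12) (n + 7) + β ^ 2 * Zm (n + 14) (n + 9) + γ ^ 2 * Zm (n + 16) (n + 9)),
    by positivity, ?_⟩
  intro φ ψ χ K h
  have b1 := h.ibp1 n
  have b2 := h.ibp2 n
  have c1 := csw h.cφ h.bφ (n + 12) (n + 10) (n + 12) (n + 13) (n + 12) (n + 7) (by omega) (by omega) (by omega) (by omega) (by omega)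
  have c2 := csw h.cψ h.bψ (n + 14) (n + 12) (n + 14) (n + 15) (n + 14) (n + 9) (by omega) (by omega) (by omega) (by omega) (by omega)
  have c3 := csw h.cχ h.bχ (n + 14) (n + 11) (n + 12) (n + 13) (n + 16) (n + 9) (by omega) (by omega) (by omega) (by omega) (by omega)
  have p1 := M_nonneg (n + 12) (n + 13) φ
  have p2 := M_nonneg (n + 14) (n + 15) ψ
  have p3 := M_nonneg (n + 12) (n + 13) χ
  change _ * M (n + 12) (n + 9) φ = _ * M (n + 12) (n + 10) φ + 4 * M (n + 14) (n + 11) ψ at b1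
  change _ * M (n + 14) (n + 11) ψ = _ * M (n + 14) (n + 12) ψ + M (n + 14) (n + 11) χ at b2
  change M (n + 12) (n + 10) φ ^ 2 ≤ M (n + 12) (n + 13) (fun r => φ r ^ 2) * Zm (n + 12) (n + 7) at c1
  change M (n + 14) (n + 12) ψ ^ 2 ≤ M (n + 14) (n + 15) (fun r => ψ r ^ 2) * Zm (n + 14) (n + 9) at c2
  change M (n + 14) (n + 11) χ ^ 2 ≤ M (n + 12) (n + 13) (fun r => χ r ^ 2) * Zm (n + 16) (n + 9) at c3
  generalize M (n + 12) (n + 13) (fun r => φ r ^ 2) = I0 at *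
  generalize M (n + 14) (n + 15) (fun r => ψ r ^ 2) = J1 at *
  generalize M (n + 12) (n + 13) (fun r => χ r ^ 2) = I2 at *
  generalize M (n + 12) (n + 9) φ = l at *
  generalize M (n + 12) (n + 10) φ = X at *
  generalize M (n + 14) (n + 12) ψ = Z at *
  generalize M (n + 14) (n + 11) χ = U at *
  generalize M (n + 14) (n + 11) ψ = Y at *
  generalize Zm (n + 12) (n + 7) = z₁ at *
  generalize Zm (n + 14) (n + 9) = z₂ at *
  generalize Zm (n + 16) (n + 9) = z₃ at *
  have hl : l = α * X + β * Z + γ * U := by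
    have e1 : Y = (2 * (n + 11) * Z + U) / (n + 7) := by
      field_simp; linarith
    have e2 : l = (2 * (n + 9) * X + 4 * Y) / (n + 5) := by
      field_simp; linarith
    rw [e2, e1]
    simp only [α, β, γ]
    field_simp
    ring
  rw [hl]
  have s1 : (α * X + β * Z + γ * U) ^ 2 ≤ 3 * (α ^ 2 * X ^ 2 + β ^ 2 * Z ^ 2 + γ ^ 2 * U ^ 2) := by
    nlinarith [sq_nonneg (α * X - β * Z), sq_nonneg (α * X - γ * U), sq_nonneg (β * Z - γ * U)]
  have s2 : α ^ 2 * X ^ 2 ≤ α ^ 2 * z₁ * (I0 + J1 + I2) := by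
    rw [mul_assoc]; gcongr; nlinarith
  have s3 : β ^ 2 * Z ^ 2 ≤ β ^ 2 * z₂ * (I0 + J1 + I2) := by
    rw [mul_assoc]; gcongr; nlinarith
  have s4 : γ ^ 2 * U ^ 2 ≤ γ ^ 2 * z₃ * (I0 + J1 + I2) := by
    rw [mul_assoc]; gcongr; nlinarith
  linarith

/-- the degree one eigenfunction -/
def tf (r : ℝ) : ℝ := (1 - r ^ 2) / (1 + r ^ 2)

theorem tf_d (r : ℝ) : HasDerivAt tf (-(4 * r / (1 + r ^ 2) ^ 2)) r := by
  have d1 : HasDerivAt (fun r : ℝ => 1 + r ^ 2) (2 * r) r := by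
    simpa using (hasDerivAt_pow 2 r).const_add 1
  have d2 : HasDerivAt (fun r : ℝ => 1 - r ^ 2) (-(2 * r)) r := by
    simpa using (hasDerivAt_pow 2 r).const_sub 1
  refine (d2.fun_div d1 (by positivity)).congr_deriv ?_
  field_simp
  ring

theorem tf_bd (r : ℝ) : |tf r| ≤ 1 := by
  unfold tf
  rw [abs_le]
  constructor
  · rw [le_div_iff₀ (by positivity)]; nlinarith
  · rw [div_le_one (by positivity)]; nlinarith [sq_nonneg r]

theorem tf_c : ContinuousOn tf (Ioi 0) := fun r _ => (tf_d r).continuousAt.continuousWithinAt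

theorem tf_M0 : M (n + 12) (n + 13) tf = 0 := by
  have i1 := wt_bdd_integrable (n + 12) (n + 13) (by omega) tf_c (fun r _ => tf_bd r)
  have := ftc_zero (B := fun r => 1 * (r ^ (n + 13) / (1 + r ^ 2) ^ (n + 13)))
    (B' := fun r => ((n:ℝ) + 13) * (tf r * (r ^ (n + 12) / (1 + r ^ 2) ^ (n + 13))))
    (by
      intro r hr
      refine ((d_wt (n + 12) (n + 12) hr).const_mul 1).congr_deriv ?_
      unfold tf
      push_cast
      field_simp
      ring) (by exact i1.const_mul _) (wt_tendsto_zero (u := fun _ => 1) (K := 1) _ _ (by omega) (by simp))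
      (wt_tendsto_top (u := fun _ => 1) (K := 1) _ _ (by omega) (by simp))
  rw [integral_const_mul] at this
  rcases mul_eq_zero.mp this with h | h
  · exfalso; have : (0:ℝ) < (n:ℝ) + 13 := by positivity
    linarith
  · exact h

theorem tf_Ml : ((n:ℝ) + 9) * M (n + 12) (n + 9) tf = - 4 * Zm (n + 12) (n + 9) := by
  have i1 := wt_bdd_integrable (n + 12) (n + 9) (by omega) tf_c (fun r _ => tf_bd r)
  have i2 := wt_integrable (n + 12) (n + 9) (by omega)
  have := ftc_zero (B := fun r => 1 * (r ^ (n + 13) / (1 + r ^ 2) ^ (n + 9)))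
    (B' := fun r => ((n:ℝ) + 9) * (tf r * (r ^ (n + 12) / (1 + r ^ 2) ^ (n + 9))) + 4 * (r ^ (n + 12) / (1 + r ^ 2) ^ (n + 9)))
    (by
      intro r hr
      refine ((d_wt (n + 12) (n + 8) hr).const_mul 1).congr_deriv ?_
      unfold tf
      push_cast
      field_simp
      ring) (by exact (i1.const_mul _).add (i2.const_mul _)) (wt_tendsto_zero (u := fun _ => 1) (K := 1) _ _ (by omega) (by simp))
      (wt_tendsto_top (u := fun _ => 1) (K := 1) _ _ (by omega) (by simp))
  rw [integral_add (i1.const_mul _) (i2.const_mul _), integral_const_mul, integral_const_mul] at this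
  unfold M Zm
  linarith

theorem M_comb (a b : ℕ) (hab : a + 2 ≤ 2 * b) {u v : ℝ → ℝ} {K L : ℝ} (hu : ContinuousOn u (Ioi 0))
    (hv : ContinuousOn v (Ioi 0))
    (hK : ∀ r, 0 < r → |u r| ≤ K) (hL : ∀ r, 0 < r → |v r| ≤ L) (c d : ℝ) :
    M a b (fun r => u r - c - d * v r) = M a b u - c * Zm a b - d * M a b v := by
  have i1 := wt_bdd_integrable a b hab hu hK
  have i2 := wt_bdd_integrable a b hab hv hL
  have i3 := wt_integrable a b hab
  unfold M Zm
  have e : ∀ r : ℝ, (u r - c - d * v r) * (r ^ a / (1 + r ^ 2) ^ b) = u r * (r ^ a / (1 + r ^ 2) ^ b)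
    - c * (r ^ a / (1 + r ^ 2) ^ b) - d * (v r * (r ^ a / (1 + r ^ 2) ^ b)) := by intro r; ring
  simp only [e]
  rw [integral_sub (by exact i1.sub (i3.const_mul _)) (i2.const_mul _), integral_sub i1 (i3.const_mul _),
    integral_const_mul, integral_const_mul]

theorem Tri.shift (h : Tri φ ψ χ K) (a b : ℝ) :
    Tri (fun r => φ r - a - b * tf r) (fun r => ψ r + b) χ (K + |a| + |b|) where
  dφ := by
    intro r hr
    refine (((h.dφ r hr).sub_const a).fun_sub ((tf_d r).const_mul b)).congr_deriv ?_
    ring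
  dψ := fun r hr => (h.dψ r hr).add_const b
  cχ := h.cχ
  bφ := by
    intro r hr
    have h1 := h.bφ r hr
    have h2 : |b * tf r| ≤ |b| := by
      rw [abs_mul]; nlinarith [tf_bd r, abs_nonneg b]
    have h3 := abs_sub (φ r - a) (b * tf r)
    have h4 := abs_sub (φ r) a
    linarith
  bψ := by
    intro r hr
    have h1 := h.bψ r hr
    have h3 := abs_add_le (ψ r) b
    have := abs_nonneg a
    linarith
  bχ := by
    intro r hr
    have h1 := h.bχ r hr
    have := abs_nonneg a
    have := abs_nonneg b
    linarith

theorem le_aux {c x y : ℝ} (hc : 1 ≤ c) (hy : 0 ≤ y) (h : c * x ≤ y) : x ≤ y := by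
  rcases le_total x 0 with h0 | h0
  · linarith
  · nlinarith

theorem T_bd : ∃ C : ℝ, 0 < C ∧ ∀ {φ ψ χ : ℝ → ℝ} {K : ℝ}, Tri φ ψ χ K →
    M (n + 12) (n + 13) (fun r => φ r ^ 2) + M (n + 14) (n + 15) (fun r => ψ r ^ 2)
      ≤ C * (M (n + 12) (n + 13) (fun r => χ r ^ 2) + M (n + 12) (n + 13) φ ^ 2
        + M (n + 12) (n + 9) φ ^ 2) := by
  obtain ⟨C0, hC0, hell⟩ := ell_bd n
  have z0 : 0 < Zm (n + 12) (n + 13) := wt_pos _ _ (by omega)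
  have z1 : 0 < Zm (n + 14) (n + 15) := wt_pos _ _ (by omega)
  have zl : 0 < Zm (n + 12) (n + 9) := wt_pos _ _ (by omega)
  have htl := tf_Ml n
  have ht0 := tf_M0 n
  set Z0 := Zm (n + 12) (n + 13) with hZ0
  set Z1 := Zm (n + 14) (n + 15) with hZ1
  set Zl := Zm (n + 12) (n + 9) with hZl
  set T := M (n + 12) (n + 9) tf with hT
  have hTne : T ≠ 0 := by
    intro h0; rw [h0] at htl; linarith
  have hT2 : 0 < T ^ 2 := by positivity
  -- b^2 ≤ C1 (I2 + A^2 + l^2)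
  set C1 : ℝ := 3 * (3 * C0 + 1 + (Zl / Z0) ^ 2) / T ^ 2 with hC1
  have hC1p : 0 < C1 := by positivity
  refine ⟨2 * (C1 * Z1 + 1) + 1 / Z0, by positivity, ?_⟩
  intro φ ψ χ K h
  have q1 := h.p1 n
  have q2 := h.p2 n
  set a : ℝ := M (n + 12) (n + 13) φ / Z0 with ha
  set b : ℝ := - (M (n + 14) (n + 15) ψ / Z1) with hb
  have hs := h.shift a b
  have r1 := hs.p1 n
  have r2 := hs.p2 n
  have r3 := hell hs
  have mA := M_comb (n + 12) (n + 13) (by omega) h.cφ tf_c h.bφ (fun r _ => tf_bd r) a b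
  have ml := M_comb (n + 12) (n + 9) (by omega) h.cφ tf_c h.bφ (fun r _ => tf_bd r) a b
  have mb := M_comb (n + 14) (n + 15) (by omega) h.cψ tf_c h.bψ (fun r _ => tf_bd r) (-b) 0
  simp only [zero_mul, sub_zero, sub_neg_eq_add] at mb
  rw [← hZ1] at mb
  have mb0 : M (n + 14) (n + 15) (fun r => ψ r + b) = 0 := by
    rw [mb, hb]; field_simp; ring
  have mA0 : M (n + 12) (n + 13) (fun r => φ r - a - b * tf r) = 0 := by
    rw [mA, ht0, ← hZ0, ha]; field_simp; ring
  rw [← hZl, ← hT] at ml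
  have p1 := M_nonneg (n + 12) (n + 13) φ
  have p2 := M_nonneg (n + 14) (n + 15) ψ
  have p3 := M_nonneg (n + 12) (n + 13) χ
  have p4 := M_nonneg (n + 12) (n + 13) (fun r => φ r - a - b * tf r)
  have p5 := M_nonneg (n + 14) (n + 15) (fun r => ψ r + b)
  change _ * (M (n + 12) (n + 13) (fun r => φ r ^ 2) - M (n + 12) (n + 13) φ ^ 2 / Z0) ≤ 4 * M (n + 14) (n + 15) (fun r => ψ r ^ 2) at q1
  change _ * (M (n + 14) (n + 15) (fun r => ψ r ^ 2) - M (n + 14) (n + 15) ψ ^ 2 / Z1) ≤ 1 / 4 * M (n + 12) (n + 13) (fun r => χ r ^ 2) at q2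
  change _ * (M (n + 12) (n + 13) (fun r => (φ r - a - b * tf r) ^ 2) - M (n + 12) (n + 13) (fun r => φ r - a - b * tf r) ^ 2 / Z0) ≤ 4 * M (n + 14) (n + 15) (fun r => (ψ r + b) ^ 2) at r1
  change _ * (M (n + 14) (n + 15) (fun r => (ψ r + b) ^ 2) - M (n + 14) (n + 15) (fun r => ψ r + b) ^ 2 / Z1) ≤ 1 / 4 * M (n + 12) (n + 13) (fun r => χ r ^ 2) at r2
  rw [mA0] at r1
  rw [mb0] at r2
  rw [ml] at r3
  have hbb : M (n + 14) (n + 15) ψ ^ 2 / Z1 = b ^ 2 * Z1 := by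
    rw [hb]; field_simp
  have haa : M (n + 12) (n + 13) φ = a * Z0 := by
    rw [ha]; field_simp
  rw [hbb] at q2
  clear_value a b
  clear hb ha hbb mb mb0 mA mA0 hell ml
  generalize M (n + 12) (n + 13) (fun r => φ r ^ 2) = I0 at *
  generalize M (n + 14) (n + 15) (fun r => ψ r ^ 2) = J1 at *
  generalize M (n + 12) (n + 13) (fun r => χ r ^ 2) = I2 at *
  generalize M (n + 12) (n + 9) φ = l at *
  generalize M (n + 12) (n + 13) (fun r => (φ r - a - b * tf r) ^ 2) = I0h at *
  generalize M (n + 14) (n + 15) (fun r => (ψ r + b) ^ 2) = J1h at *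
  generalize M (n + 12) (n + 13) φ = A at *
  have hn : (0:ℝ) ≤ n := Nat.cast_nonneg n
  have u1 : J1h ≤ I2 := by
    refine le_aux (c := ((n:ℝ) + 15) * 4) (by linarith) p3 ?_
    have e : (0:ℝ) ^ 2 / Z1 = 0 := by simp
    rw [e] at r2
    linarith
  have u2 : I0h ≤ J1h := by
    refine le_aux (c := ((n:ℝ) + 13) / 4) (by linarith) p5 ?_
    have e : (0:ℝ) ^ 2 / Z0 = 0 := by simp
    rw [e] at r1
    linarith
  have u3 : (l - a * Zl - b * T) ^ 2 ≤ 3 * C0 * I2 := by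
    refine r3.trans ?_
    rw [mul_comm 3 C0, mul_assoc]
    gcongr
    linarith
  have u4 : b ^ 2 * T ^ 2 ≤ 3 * (3 * C0 + 1 + (Zl / Z0) ^ 2) * (I2 + A ^ 2 + l ^ 2) := by
    have v1 : b ^ 2 * T ^ 2 ≤ 3 * ((l - a * Zl - b * T) ^ 2 + l ^ 2 + (a * Zl) ^ 2) := by
      nlinarith [sq_nonneg ((l - a * Zl - b * T) + l), sq_nonneg ((l - a * Zl - b * T) - a * Zl), sq_nonneg (l + a * Zl)]
    have v2 : (a * Zl) ^ 2 = (Zl / Z0) ^ 2 * A ^ 2 := by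
      rw [haa]; field_simp
    rw [v2] at v1
    have w1 : 0 ≤ C0 * (A ^ 2 + l ^ 2) := by positivity
    have w2 : 0 ≤ (Zl / Z0) ^ 2 * (I2 + l ^ 2) := by positivity
    have w3 : 0 ≤ I2 + A ^ 2 := by positivity
    linear_combination v1 + 3 * u3 + 9 * w1 + 3 * w2 + 3 * w3
  have u5 : b ^ 2 ≤ C1 * (I2 + A ^ 2 + l ^ 2) := by
    rw [hC1, div_mul_eq_mul_div, le_div_iff₀ hT2]; exact u4
  have u6 : J1 ≤ b ^ 2 * Z1 + I2 := by
    have := le_aux (c := ((n:ℝ) + 15) * 4) (x := J1 - b ^ 2 * Z1) (by linarith) p3 (by linarith)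
    linarith
  have u7 : I0 ≤ A ^ 2 / Z0 + J1 := by
    have := le_aux (c := ((n:ℝ) + 13) / 4) (x := I0 - A ^ 2 / Z0) (by linarith) p2 (by linarith)
    linarith
  have u8 : b ^ 2 * Z1 ≤ C1 * Z1 * (I2 + A ^ 2 + l ^ 2) := by
    calc b ^ 2 * Z1 ≤ (C1 * (I2 + A ^ 2 + l ^ 2)) * Z1 := by gcongr
      _ = _ := by ring
  have u9 : A ^ 2 / Z0 ≤ 1 / Z0 * (I2 + A ^ 2 + l ^ 2) := by
    rw [div_eq_mul_one_div, mul_comm]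
    gcongr
    nlinarith [sq_nonneg l]
  have u10 : 0 ≤ A ^ 2 + l ^ 2 := by positivity
  linear_combination u7 + 2 * u6 + 2 * u8 + u9 + 2 * u10

theorem energy_alg (m r f p c w : ℝ) (hr : r ≠ 0) :
    ((0 * (1 + r ^ 2) - 2 * (m + 11) * (2 * r)) / (1 + r ^ 2) ^ 2 * p ^ 2 +
              (-(m + 9) + 2 * (m + 11) / (1 + r ^ 2)) * (2 * p ^ 1 * (c / r)) -
            (2 * ((m + 9) / 2 * (2 * r)) * (f * p) +
              2 * ((m + 9) / 2 * (1 + r ^ 2 + (m + 11) / 2)) * (4 * r * p / (1 + r ^ 2) ^ 2 * p + f * (c / r))) +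
          ((-((m + 9) / 4) * (2 * (1 + r ^ 2) ^ 1 * (2 * r)) - (m + 9) * (m + 11) / 4 * (2 * r)) * f ^ 2 +
            (-((m + 9) / 4) * (1 + r ^ 2) ^ 2 - (m + 9) * (m + 11) / 4 * (1 + r ^ 2)) *
              (2 * f ^ 1 * (4 * r * p / (1 + r ^ 2) ^ 2)))) *
        (r * w) +
      ((-(m + 9) + 2 * (m + 11) / (1 + r ^ 2)) * p ^ 2 - 2 * ((m + 9) / 2 * (1 + r ^ 2 + (m + 11) / 2)) * (f * p) +
          (-((m + 9) / 4) * (1 + r ^ 2) ^ 2 - (m + 9) * (m + 11) / 4 * (1 + r ^ 2)) * f ^ 2) *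
        ((m + 12 + 1) * w - 2 * (m + 12 + 1) * (r ^ 2 / (1 + r ^ 2) * w)) =
    (c + (-(m + 9) + 2 * (m + 11) / (1 + r ^ 2)) * p - (m + 9) / 2 * (1 + r ^ 2 + (m + 11) / 2) * f) ^ 2 * w -
          c ^ 2 * w -
        4 * (((m + 13) ^ 2 - 4) / 2) * (p ^ 2 * (r ^ 2 / (1 + r ^ 2) ^ 2 * w)) -
      (m + 9) * (m + 11) * (m + 13) * (m + 15) / 16 * (f ^ 2 * w) := by
  obtain ⟨q, hq⟩ : ∃ q, q = 1 + r ^ 2 := ⟨_, rfl⟩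
  have hq0 : q ≠ 0 := by rw [hq]; positivity
  have hr2 : r ^ 2 = q - 1 := by rw [hq]; ring
  rw [← hq]
  have e1 : c / r * r = c := by field_simp
  obtain ⟨d, hd⟩ : ∃ d, d = c / r := ⟨_, rfl⟩
  rw [← hd] at e1 ⊢
  -- coefficients of the quadratic form
  have A1 : ((0 * q - 2 * (m + 11) * (2 * r)) / q ^ 2 - 2 * ((m + 9) / 2 * (q + (m + 11) / 2)) * (4 * r / q ^ 2)) * r
      + (-(m + 9) + 2 * (m + 11) / q) * (m + 13) * (1 - 2 * (r ^ 2 / q))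
      = (-(m + 9) + 2 * (m + 11) / q) ^ 2 - 4 * (((m + 13) ^ 2 - 4) / 2) * (r ^ 2 / q ^ 2) := by
    field_simp
    linear_combination (-968 + 396 * q + 80 * q * m + 4 * q * m ^ 2 - 176 * m - 8 * m ^ 2) * hr2
  have A2 : -(2 * ((m + 9) / 2 * (2 * r))) * r
      + (-((m + 9) / 4) * q ^ 2 - (m + 9) * (m + 11) / 4 * q) * (2 * (4 * r / q ^ 2)) * r
      - 2 * ((m + 9) / 2 * (q + (m + 11) / 2)) * (m + 13) * (1 - 2 * (r ^ 2 / q))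
      = -2 * (-(m + 9) + 2 * (m + 11) / q) * ((m + 9) / 2 * (q + (m + 11) / 2)) := by
    field_simp
    rw [hr2]
    ring
  have A3 : (-((m + 9) / 4) * (2 * q * (2 * r)) - (m + 9) * (m + 11) / 4 * (2 * r)) * r
      + (-((m + 9) / 4) * q ^ 2 - (m + 9) * (m + 11) / 4 * q) * (m + 13) * (1 - 2 * (r ^ 2 / q))
      = ((m + 9) / 2 * (q + (m + 11) / 2)) ^ 2 - (m + 9) * (m + 11) * (m + 13) * (m + 15) / 16 := by
    field_simp
    rw [hr2]
    ring
  linear_combination (w * p ^ 2) * A1 + (w * f * p) * A2 + (w * f ^ 2) * A3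
    + (2 * (-(m + 9) + 2 * (m + 11) / q) * p - 2 * ((m + 9) / 2 * (q + (m + 11) / 2)) * f) * w * e1

theorem Tri.energy (h : Tri φ ψ χ K) :
    M (n + 12) (n + 13) (fun r => (χ r + (-((n:ℝ) + 9) + 2 * (n + 11) / (1 + r ^ 2)) * ψ r
      - ((n:ℝ) + 9) / 2 * (1 + r ^ 2 + (n + 11) / 2) * φ r) ^ 2)
    = M (n + 12) (n + 13) (fun r => χ r ^ 2)
      + 4 * ((((n:ℝ) + 13) ^ 2 - 4) / 2) * M (n + 14) (n + 15) (fun r => ψ r ^ 2)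
      + ((n:ℝ) + 9) * (n + 11) * (n + 13) * (n + 15) / 16 * M (n + 12) (n + 13) (fun r => φ r ^ 2) := by
  have i0 := h.iφ n
  have i1 := h.iψ n
  have i2 := h.iχ n
  have hK0 : 0 ≤ K := (abs_nonneg _).trans (h.bφ 1 one_pos)
  set S : ℝ → ℝ := fun r => χ r + (-((n:ℝ) + 9) + 2 * (n + 11) / (1 + r ^ 2)) * ψ r
      - ((n:ℝ) + 9) / 2 * (1 + r ^ 2 + (n + 11) / 2) * φ r with hS
  have hd : ∀ r : ℝ, 1 + r ^ 2 ≠ 0 := fun r => by positivity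
  have hSc : ContinuousOn S (Ioi 0) := by
    have := h.cφ
    have := h.cψ
    have := h.cχ
    simp only [hS]
    have hq : ContinuousOn (fun r : ℝ => 2 * ((n:ℝ) + 11) / (1 + r ^ 2)) (Ioi 0) :=
      ContinuousOn.div (by fun_prop) (by fun_prop) (fun r _ => hd r)
    fun_prop
  have hSb : ∀ r, 0 < r → |S r / (1 + r ^ 2)| ≤ (1 + (3 * n + 31) + (n + 9) * (n + 13)) * K := by
    intro r hr
    rw [abs_div, abs_of_pos (by positivity : 0 < 1 + r ^ 2), div_le_iff₀ (by positivity)]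
    have t1 := h.bφ r hr
    have t2 := h.bψ r hr
    have t3 := h.bχ r hr
    have a1 : |-((n:ℝ) + 9) + 2 * (n + 11) / (1 + r ^ 2)| ≤ 3 * (n:ℝ) + 31 := by
      have : 2 * ((n:ℝ) + 11) / (1 + r ^ 2) ≤ 2 * (n + 11) := div_le_self (by positivity) (by nlinarith)
      have h0 : 0 ≤ 2 * ((n:ℝ) + 11) / (1 + r ^ 2) := by positivity
      have hn : (0:ℝ) ≤ n := Nat.cast_nonneg n
      rw [abs_le]; constructor <;> linarith
    have a2 : |((n:ℝ) + 9) / 2 * (1 + r ^ 2 + (n + 11) / 2)| ≤ (n + 9) * (n + 13) * (1 + r ^ 2) := by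
      rw [abs_of_nonneg (by positivity), mul_assoc, div_mul_eq_mul_div]
      rw [div_le_iff₀ (by norm_num), mul_assoc]
      gcongr
      have hn : (0:ℝ) ≤ n := Nat.cast_nonneg n
      nlinarith [mul_nonneg hn (sq_nonneg r), sq_nonneg r]
    have b1 : |S r| ≤ |χ r| + |(-((n:ℝ) + 9) + 2 * (n + 11) / (1 + r ^ 2)) * ψ r| + |((n:ℝ) + 9) / 2 * (1 + r ^ 2 + (n + 11) / 2) * φ r| := by
      simp only [hS]
      exact (abs_sub _ _).trans (by gcongr; exact abs_add_le _ _)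
    rw [abs_mul, abs_mul] at b1
    have c1 := mul_le_mul a1 t2 (abs_nonneg _) (by positivity)
    have c2 := mul_le_mul a2 t1 (abs_nonneg _) (by positivity)
    have hn : (0:ℝ) ≤ n := Nat.cast_nonneg n
    have c3 : (1 + (3 * (n:ℝ) + 31)) * K ≤ (1 + (3 * n + 31)) * K * (1 + r ^ 2) :=
      le_mul_of_one_le_right (by positivity) (by nlinarith)
    nlinarith
  have i3' := wt_bdd_integrable (n + 12) (n + 11) (by omega) (u := fun r => (S r / (1 + r ^ 2)) ^ 2)
    ((hSc.div (by fun_prop) (fun r _ => hd r)).pow 2) (sq_bd hSb)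
  have i3 : IntegrableOn (fun r => S r ^ 2 * (r ^ (n + 12) / (1 + r ^ 2) ^ (n + 13))) (Ioi 0) := by
    refine i3'.congr_fun ?_ measurableSet_Ioi
    intro r hr
    simp only
    have := hd r
    field_simp
    ring
  -- the boundary function
  set F : ℝ → ℝ := fun r => ((-((n:ℝ) + 9) + 2 * (n + 11) / (1 + r ^ 2)) * ψ r ^ 2
      - 2 * (((n:ℝ) + 9) / 2 * (1 + r ^ 2 + (n + 11) / 2)) * (φ r * ψ r)
      + (-(((n:ℝ) + 9) / 4) * (1 + r ^ 2) ^ 2 - ((n:ℝ) + 9) * (n + 11) / 4 * (1 + r ^ 2)) * φ r ^ 2) with hF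
  have hFb : ∀ r, 0 < r → |F r / (1 + r ^ 2) ^ 2| ≤
      ((3 * n + 31) + 2 * ((n + 9) * (n + 13)) + (n + 9) * (n + 13)) * K ^ 2 := by
    intro r hr
    rw [abs_div, abs_of_pos (by positivity : 0 < (1 + r ^ 2) ^ 2), div_le_iff₀ (by positivity)]
    have hn : (0:ℝ) ≤ n := Nat.cast_nonneg n
    have t1 := h.bφ r hr
    have t2 := h.bψ r hr
    have q1 : 1 ≤ 1 + r ^ 2 := by nlinarith
    have q2 : 1 + r ^ 2 ≤ (1 + r ^ 2) ^ 2 := by nlinarith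
    have a1 : |-((n:ℝ) + 9) + 2 * (n + 11) / (1 + r ^ 2)| ≤ (3 * n + 31) * (1 + r ^ 2) ^ 2 := by
      have : 2 * ((n:ℝ) + 11) / (1 + r ^ 2) ≤ 2 * (n + 11) := div_le_self (by positivity) (by nlinarith)
      have h0 : 0 ≤ 2 * ((n:ℝ) + 11) / (1 + r ^ 2) := by positivity
      have h1 : |-((n:ℝ) + 9) + 2 * (n + 11) / (1 + r ^ 2)| ≤ 3 * (n:ℝ) + 31 := by
        rw [abs_le]; constructor <;> linarith
      exact h1.trans (le_mul_of_one_le_right (by positivity) (by linarith))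
    have a2 : |2 * (((n:ℝ) + 9) / 2 * (1 + r ^ 2 + (n + 11) / 2))| ≤ 2 * ((n + 9) * (n + 13)) * (1 + r ^ 2) ^ 2 := by
      rw [abs_of_nonneg (by positivity)]
      have : 1 + r ^ 2 + ((n:ℝ) + 11) / 2 ≤ (n + 13) * (1 + r ^ 2) ^ 2 := by
        nlinarith [mul_nonneg hn (sq_nonneg r), sq_nonneg r, mul_le_mul_of_nonneg_left q2 hn]
      have := mul_le_mul_of_nonneg_left this (by positivity : 0 ≤ (n:ℝ) + 9)
      have h9 : 0 ≤ ((n:ℝ) + 9) * (1 + r ^ 2 + ((n:ℝ) + 11) / 2) := by positivity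
      linarith
    have a3 : |-(((n:ℝ) + 9) / 4) * (1 + r ^ 2) ^ 2 - ((n:ℝ) + 9) * (n + 11) / 4 * (1 + r ^ 2)| ≤ (n + 9) * (n + 13) * (1 + r ^ 2) ^ 2 := by
      have g1 : 0 ≤ (((n:ℝ) + 9) / 4) * (1 + r ^ 2) ^ 2 := by positivity
      have g2 : 0 ≤ ((n:ℝ) + 9) * (n + 11) / 4 * (1 + r ^ 2) := by positivity
      have g3 : ((n:ℝ) + 9) * (n + 11) / 4 * (1 + r ^ 2) ≤ ((n:ℝ) + 9) * (n + 11) / 4 * (1 + r ^ 2) ^ 2 := by gcongr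
      have g4 : 0 ≤ ((n:ℝ) + 9) * (n + 11) * (1 + r ^ 2) ^ 2 := by positivity
      rw [abs_le]; constructor <;> nlinarith
    have e1 : |ψ r ^ 2| ≤ K ^ 2 := sq_bd h.bψ r hr
    have e2 : |φ r ^ 2| ≤ K ^ 2 := sq_bd h.bφ r hr
    have e3 : |φ r * ψ r| ≤ K ^ 2 := by
      rw [abs_mul, sq]; exact mul_le_mul t1 t2 (abs_nonneg _) hK0
    have c1 := mul_le_mul a1 e1 (abs_nonneg _) (by positivity)
    have c2 := mul_le_mul a2 e3 (abs_nonneg _) (by positivity)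
    have c3 := mul_le_mul a3 e2 (abs_nonneg _) (by positivity)
    rw [← abs_mul] at c1 c2 c3
    have d1 := abs_add_le ((-((n:ℝ) + 9) + 2 * (n + 11) / (1 + r ^ 2)) * ψ r ^ 2
      - 2 * (((n:ℝ) + 9) / 2 * (1 + r ^ 2 + (n + 11) / 2)) * (φ r * ψ r)) ((-(((n:ℝ) + 9) / 4) * (1 + r ^ 2) ^ 2 - ((n:ℝ) + 9) * (n + 11) / 4 * (1 + r ^ 2)) * φ r ^ 2)
    have d2 := abs_sub ((-((n:ℝ) + 9) + 2 * (n + 11) / (1 + r ^ 2)) * ψ r ^ 2)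
      (2 * (((n:ℝ) + 9) / 2 * (1 + r ^ 2 + (n + 11) / 2)) * (φ r * ψ r))
    change |F r| ≤ _ at d1
    linarith
  have i4 := ((i3.sub i2).sub (i1.const_mul (4 * ((((n:ℝ) + 13) ^ 2 - 4) / 2)))).sub
    (i0.const_mul (((n:ℝ) + 9) * (n + 11) * (n + 13) * (n + 15) / 16))
  have key := ftc_zero (B := fun r => F r * (r ^ (n + 13) / (1 + r ^ 2) ^ (n + 13)))
    (B' := fun r => S r ^ 2 * (r ^ (n + 12) / (1 + r ^ 2) ^ (n + 13))
      - χ r ^ 2 * (r ^ (n + 12) / (1 + r ^ 2) ^ (n + 13))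
      - 4 * ((((n:ℝ) + 13) ^ 2 - 4) / 2) * (ψ r ^ 2 * (r ^ (n + 14) / (1 + r ^ 2) ^ (n + 15)))
      - ((n:ℝ) + 9) * (n + 11) * (n + 13) * (n + 15) / 16 * (φ r ^ 2 * (r ^ (n + 12) / (1 + r ^ 2) ^ (n + 13))))
    (by
      intro r hr
      have dq : HasDerivAt (fun r : ℝ => 1 + r ^ 2) (2 * r) r := by
        simpa using (hasDerivAt_pow 2 r).const_add 1
      have da := ((hasDerivAt_const r (2 * ((n:ℝ) + 11))).fun_div dq (hd r)).const_add (-((n:ℝ) + 9))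
      have db := (dq.add_const (((n:ℝ) + 11) / 2)).const_mul (((n:ℝ) + 9) / 2)
      have dg := ((dq.fun_pow 2).const_mul (-(((n:ℝ) + 9) / 4))).fun_sub (dq.const_mul (((n:ℝ) + 9) * (n + 11) / 4))
      have dF := ((da.fun_mul ((h.dψ r hr).fun_pow 2)).fun_sub ((db.const_mul 2).fun_mul ((h.dφ r hr).fun_mul (h.dψ r hr)))).fun_add
        (dg.fun_mul ((h.dφ r hr).fun_pow 2))
      refine (dF.fun_mul (d_wt (n + 12) (n + 12) hr)).congr_deriv ?_
      have hr' : 0 < r := hr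
      have w1 : r ^ (n + 12 + 1) / (1 + r ^ 2) ^ (n + 12 + 1) = r * (r ^ (n + 12) / (1 + r ^ 2) ^ (n + 13)) := by
        rw [pow_succ r]; ring
      have w2 : r ^ (n + 12 + 2) / (1 + r ^ 2) ^ (n + 12 + 2) = r ^ 2 / (1 + r ^ 2) * (r ^ (n + 12) / (1 + r ^ 2) ^ (n + 13)) := by
        rw [pow_add r, pow_succ (1 + r ^ 2) (n + 12 + 1)]; field_simp
      have w3 : r ^ (n + 14) / (1 + r ^ 2) ^ (n + 15) = r ^ 2 / (1 + r ^ 2) ^ 2 * (r ^ (n + 12) / (1 + r ^ 2) ^ (n + 13)) := by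
        rw [show n + 14 = n + 12 + 2 from rfl, show n + 15 = n + 13 + 2 from rfl, pow_add r, pow_add (1 + r ^ 2)]
        field_simp
      have w0 : r ^ (n + 12) / (1 + r ^ 2) ^ (n + 12 + 1) = r ^ (n + 12) / (1 + r ^ 2) ^ (n + 13) := rfl
      simp only [hS]
      rw [w1, w2, w3, w0]
      push_cast
      generalize r ^ (n + 12) / (1 + r ^ 2) ^ (n + 13) = w
      generalize (n:ℝ) = m
      have hq := hd r
      have hrq : r ^ 2 = (1 + r ^ 2) - 1 := by ring
      generalize φ r = f
      generalize ψ r = p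
      generalize χ r = c
      exact energy_alg m r f p c w hr'.ne') (by exact i4) (by
        refine (wt_tendsto_zero (n + 13) (n + 11) (by omega) hFb).congr ?_
        intro r
        have := hd r
        field_simp
        ring) (by
        refine (wt_tendsto_top (n + 13) (n + 11) (by omega) hFb).congr ?_
        intro r
        have := hd r
        field_simp
        ring)
  rw [integral_sub (by exact ((i3.sub i2).sub (i1.const_mul (4 * ((((n:ℝ) + 13) ^ 2 - 4) / 2))))) (i0.const_mul _),
    integral_sub (by exact (i3.sub i2)) (i1.const_mul _), integral_sub i3 i2, integral_const_mul, integral_const_mul] at key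
  unfold M
  linarith

end
end Rad

namespace Rad
open Set Filter Topology

theorem schw_bd (f : SchwartzMap ℝ ℝ) (m : ℕ) : ∃ C : ℝ, 0 ≤ C ∧ ∀ r, (1 + r ^ 2) ^ m * |f r| ≤ C := by
  have h := fun r => SchwartzMap.one_add_le_sup_seminorm_apply (𝕜 := ℝ) (m := (2 * m, 0)) (k := 2 * m) (n := 0)
    le_rfl le_rfl f r
  refine ⟨_, ?_, fun r => le_trans ?_ (h r)⟩
  · exact le_trans (by positivity) (h 0)
  · rw [norm_iteratedFDeriv_zero, Real.norm_eq_abs (f r), pow_mul]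
    gcongr
    rw [Real.norm_eq_abs]
    nlinarith [sq_abs r, abs_nonneg r]

def Gf (n : ℕ) (r : ℝ) : ℝ := √(1 + r ^ 2) ^ (n + 9)

theorem Gf_pos (n : ℕ) (r : ℝ) : 0 < Gf n r := by unfold Gf; positivity

theorem Gf_le (n : ℕ) (r : ℝ) : Gf n r ≤ (1 + r ^ 2) ^ (n + 9) := by
  unfold Gf
  have h1 : (1:ℝ) ≤ 1 + r ^ 2 := by nlinarith [sq_nonneg r]
  gcongr
  rw [Real.sqrt_le_left (by positivity)]
  nlinarith

theorem Gf_d (n : ℕ) (r : ℝ) : HasDerivAt (Gf n) ((n + 9) * r * Gf n r / (1 + r ^ 2)) r := by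
  have d1 : HasDerivAt (fun r : ℝ => 1 + r ^ 2) (2 * r) r := by
    simpa using (hasDerivAt_pow 2 r).const_add 1
  have d2 := (d1.sqrt (by positivity)).fun_pow (n + 9)
  refine d2.congr_deriv ?_
  unfold Gf
  have hs : √(1 + r ^ 2) ^ 2 = 1 + r ^ 2 := Real.sq_sqrt (by positivity)
  have hp : 0 < √(1 + r ^ 2) := by positivity
  rw [← hs]
  rw [Real.sqrt_sq hp.le]
  generalize √(1 + r ^ 2) = s at *
  push_cast
  try rw [show n + 9 - 1 = n + 8 by omega]
  field_simp
  ring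

def pφ (n : ℕ) (f : SchwartzMap ℝ ℝ) (r : ℝ) : ℝ := Gf n r * f r
def pψ (n : ℕ) (f : SchwartzMap ℝ ℝ) (r : ℝ) : ℝ :=
  Gf n r * ((1 + r ^ 2) ^ 2 * (deriv f r / r) / 4 + (n + 9) / 4 * (1 + r ^ 2) * f r)
def pχ (n : ℕ) (f : SchwartzMap ℝ ℝ) (r : ℝ) : ℝ :=
  Gf n r * ((n + 11) / 2 * (1 + r ^ 2) * r * deriv f r + (n + 9) * (n + 11) / 4 * r ^ 2 * f r
    + (1 + r ^ 2) ^ 2 * deriv (deriv f) r / 4 - (1 + r ^ 2) ^ 2 * (deriv f r / r) / 4)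

theorem schw_d (f : SchwartzMap ℝ ℝ) (r : ℝ) : HasDerivAt f (deriv f r) r := f.differentiableAt.hasDerivAt

theorem schw_deriv (f : SchwartzMap ℝ ℝ) : ∃ f1 : SchwartzMap ℝ ℝ, ∀ r, f1 r = deriv f r :=
  ⟨SchwartzMap.derivCLM ℝ ℝ f, fun r => by simp⟩

theorem schw_d2 (f : SchwartzMap ℝ ℝ) (r : ℝ) : HasDerivAt (deriv f) (deriv (deriv f) r) r := by
  obtain ⟨f1, h1⟩ := schw_deriv f
  have : (⇑f1) = deriv f := funext h1
  rw [← this]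
  exact schw_d f1 r

theorem schw_p_bd (f : SchwartzMap ℝ ℝ) (hev : ∀ r, f (-r) = f r) (m : ℕ) :
    ∃ C : ℝ, 0 ≤ C ∧ ∀ r, 0 < r → (1 + r ^ 2) ^ m * |f r| ≤ C ∧ (1 + r ^ 2) ^ m * |deriv f r| ≤ C
      ∧ (1 + r ^ 2) ^ m * |deriv (deriv f) r| ≤ C ∧ (1 + r ^ 2) ^ m * |deriv f r / r| ≤ C := by
  obtain ⟨f1, h1⟩ := schw_deriv f
  obtain ⟨f2, h2⟩ := schw_deriv f1
  have e1 : (⇑f1) = deriv f := funext h1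
  have e2 : (⇑f2) = deriv (deriv f) := by rw [← e1]; exact funext h2
  obtain ⟨C0, p0, c0⟩ := schw_bd f m
  obtain ⟨C1, p1, c1⟩ := schw_bd f1 m
  obtain ⟨C2, p2, c2⟩ := schw_bd f2 m
  obtain ⟨C3, p3, c3⟩ := schw_bd f2 0
  rw [← e2, ← e1]
  have hz : f1 0 = 0 := by
    have a1 : HasDerivAt (fun r => f (-r)) (- f1 0) 0 := by
      have h0 : HasDerivAt f (f1 0) (-0) := by rw [neg_zero, h1]; exact schw_d f 0
      have h3 := h0.comp (0:ℝ) (hasDerivAt_neg (0:ℝ))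
      rw [mul_neg_one] at h3
      exact h3
    have a2 : HasDerivAt (fun r => f (-r)) (f1 0) 0 := by
      simp only [hev]; rw [h1]; exact schw_d f 0
    have := a1.unique a2
    linarith
  have hmv : ∀ r, 0 < r → |f1 r| ≤ C3 * r := by
    intro r hr
    have := Convex.norm_image_sub_le_of_norm_hasDerivWithin_le (f := f1) (f' := f2) (C := C3) (s := univ) (x := 0) (y := r)
      (fun x _ => by rw [h2]; exact (schw_d f1 x).hasDerivWithinAt) (fun x _ => by simpa using c3 x) convex_univ trivial trivial
    simpa [hz, abs_of_pos hr] using this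
  refine ⟨C0 + C1 + C2 + 2 ^ m * C3, by positivity, ?_⟩
  intro r hr
  have q3 : 0 ≤ 2 ^ m * C3 := by positivity
  refine ⟨by linarith [c0 r], by linarith [c1 r], by linarith [c2 r], ?_⟩
  rw [abs_div, abs_of_pos hr]
  rcases le_total 1 r with h | h
  · have : |f1 r| / r ≤ |f1 r| := div_le_self (abs_nonneg _) h
    have h5 : (1 + r ^ 2) ^ m * (|f1 r| / r) ≤ (1 + r ^ 2) ^ m * |f1 r| := by gcongr
    linarith [c1 r]
  · have h5 : |f1 r| / r ≤ C3 := by rw [div_le_iff₀ hr]; exact hmv r hr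
    have h6 : (1 + r ^ 2) ^ m * (|f1 r| / r) ≤ 2 ^ m * C3 := by
      gcongr
      nlinarith
    linarith

theorem tri_of_schw (n : ℕ) (f : SchwartzMap ℝ ℝ) (hev : ∀ r, f (-r) = f r) :
    ∃ K, Tri (pφ n f) (pψ n f) (pχ n f) K := by
  obtain ⟨C, hC, hb⟩ := schw_p_bd f hev (n + 11)
  have hn : (0:ℝ) ≤ n := Nat.cast_nonneg n
  set D : ℝ := (1 + (n + 9) + (n + 11) + (n + 9) * (n + 11) + 1 + 1) * C with hD
  have aux : ∀ r, 0 < r → |f r| * (Gf n r * (1 + r ^ 2) ^ 2) ≤ C ∧ |deriv f r| * (Gf n r * (1 + r ^ 2) ^ 2) ≤ C ∧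
      |deriv (deriv f) r| * (Gf n r * (1 + r ^ 2) ^ 2) ≤ C ∧ |deriv f r / r| * (Gf n r * (1 + r ^ 2) ^ 2) ≤ C := by
    intro r hr
    have h1 : Gf n r * (1 + r ^ 2) ^ 2 ≤ (1 + r ^ 2) ^ (n + 11) := by
      calc Gf n r * (1 + r ^ 2) ^ 2 ≤ (1 + r ^ 2) ^ (n + 9) * (1 + r ^ 2) ^ 2 := by gcongr; exact Gf_le n r
        _ = _ := by ring
    obtain ⟨a1, a2, a3, a4⟩ := hb r hr
    refine ⟨le_trans ?_ a1, le_trans ?_ a2, le_trans ?_ a3, le_trans ?_ a4⟩ <;>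
    · rw [mul_comm]; gcongr
  refine ⟨D, ?_, ?_, ?_, ?_, ?_, ?_⟩
  · intro r hr
    refine ((Gf_d n r).fun_mul (schw_d f r)).congr_deriv ?_
    unfold pψ
    field_simp
    ring
  · intro r hr
    have d1 : HasDerivAt (fun r : ℝ => 1 + r ^ 2) (2 * r) r := by
      simpa using (hasDerivAt_pow 2 r).const_add 1
    have d2 := (Gf_d n r).fun_mul ((((d1.fun_pow 2).fun_mul ((schw_d2 f r).fun_div (hasDerivAt_id r) hr.ne')).div_const 4).fun_add
      ((d1.const_mul (((n:ℝ) + 9) / 4)).fun_mul (schw_d f r)))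
    refine d2.congr_deriv ?_
    unfold pχ
    simp only [id]
    push_cast
    field_simp
    ring
  · have c1 : ContinuousOn (Gf n) (Ioi 0) := fun r _ => (Gf_d n r).continuousAt.continuousWithinAt
    have c2 : ContinuousOn f (Ioi 0) := f.continuous.continuousOn
    have c3 : ContinuousOn (deriv f) (Ioi 0) := fun r _ => (schw_d2 f r).continuousAt.continuousWithinAt
    have c4 : ContinuousOn (deriv (deriv f)) (Ioi 0) := by
      obtain ⟨f1, h1⟩ := schw_deriv f
      obtain ⟨f2, h2⟩ := schw_deriv f1
      have e1 : (⇑f1) = deriv f := funext h1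
      have e2 : (⇑f2) = deriv (deriv f) := by rw [← e1]; exact funext h2
      rw [← e2]; exact f2.continuous.continuousOn
    have c5 : ContinuousOn (fun r => deriv f r / r) (Ioi 0) := c3.div continuousOn_id (fun r hr => (ne_of_gt hr))
    unfold pχ
    fun_prop
  · intro r hr
    obtain ⟨a1, a2, a3, a4⟩ := aux r hr
    have g0 := Gf_pos n r
    unfold pφ
    rw [abs_mul, abs_of_pos g0]
    have : |f r| * Gf n r ≤ |f r| * (Gf n r * (1 + r ^ 2) ^ 2) := by
      gcongr; exact le_mul_of_one_le_right g0.le (one_le_pow₀ (by nlinarith))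
    have hh : C ≤ D := le_mul_of_one_le_left hC (by nlinarith)
    linarith
  · intro r hr
    obtain ⟨a1, a2, a3, a4⟩ := aux r hr
    have g0 := Gf_pos n r
    unfold pψ
    rw [abs_mul, abs_of_pos g0]
    have t1 : |(1 + r ^ 2) ^ 2 * (deriv f r / r) / 4 + ((n:ℝ) + 9) / 4 * (1 + r ^ 2) * f r| ≤
       (1 + r ^ 2) ^ 2 * (|deriv f r / r| + (n + 9) * |f r|) := by
      refine (abs_add_le _ _).trans ?_
      rw [abs_div, abs_mul, abs_mul _ (f r), abs_of_pos (by positivity : (0:ℝ) < (1 + r ^ 2) ^ 2),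
        abs_of_pos (by positivity : (0:ℝ) < ((n:ℝ) + 9) / 4 * (1 + r ^ 2)), abs_of_pos (by norm_num : (0:ℝ) < 4)]
      have h1 : (1 + r ^ 2) ^ 2 * |deriv f r / r| / 4 ≤ (1 + r ^ 2) ^ 2 * |deriv f r / r| := div_le_self (by positivity) (by norm_num)
      have h2 : ((n:ℝ) + 9) / 4 * (1 + r ^ 2) * |f r| ≤ ((n:ℝ) + 9) * (1 + r ^ 2) ^ 2 * |f r| := by
        gcongr
        · linarith
        · nlinarith [sq_nonneg r]
      linarith
    calc Gf n r * _ ≤ Gf n r * ((1 + r ^ 2) ^ 2 * (|deriv f r / r| + (n + 9) * |f r|)) := by gcongr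
      _ = |deriv f r / r| * (Gf n r * (1 + r ^ 2) ^ 2) + (n + 9) * (|f r| * (Gf n r * (1 + r ^ 2) ^ 2)) := by ring
      _ ≤ C + (n + 9) * C := by gcongr
      _ ≤ D := by
        rw [hD]
        have : 0 ≤ ((n + 11) + (n + 9) * (n + 11) + 1 + 1) * C := by positivity
        linarith
  · intro r hr
    obtain ⟨a1, a2, a3, a4⟩ := aux r hr
    have g0 := Gf_pos n r
    unfold pχ
    rw [abs_mul, abs_of_pos g0]
    have hr2 : r ≤ 1 + r ^ 2 := by nlinarith [sq_nonneg (r - 1)]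
    have t1 : |((n:ℝ) + 11) / 2 * (1 + r ^ 2) * r * deriv f r + (n + 9) * (n + 11) / 4 * r ^ 2 * f r
    + (1 + r ^ 2) ^ 2 * deriv (deriv f) r / 4 - (1 + r ^ 2) ^ 2 * (deriv f r / r) / 4| ≤
       (1 + r ^ 2) ^ 2 * ((n + 11) * |deriv f r| + (n + 9) * (n + 11) * |f r| + |deriv (deriv f) r| + |deriv f r / r|) := by
      refine (abs_sub _ _).trans ?_
      have s1 := abs_add_three (((n:ℝ) + 11) / 2 * (1 + r ^ 2) * r * deriv f r) ((n + 9) * (n + 11) / 4 * r ^ 2 * f r)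
        ((1 + r ^ 2) ^ 2 * deriv (deriv f) r / 4)
      rw [abs_mul _ (deriv f r), abs_mul _ (f r), abs_div _ 4, abs_mul _ (deriv (deriv f) r), abs_of_pos (by positivity : (0:ℝ) < (1 + r ^ 2) ^ 2),
        abs_of_pos (by positivity : (0:ℝ) < ((n:ℝ) + 11) / 2 * (1 + r ^ 2) * r),
        abs_of_pos (by positivity : (0:ℝ) < ((n:ℝ) + 9) * (n + 11) / 4 * r ^ 2), abs_of_pos (by norm_num : (0:ℝ) < 4)] at s1
      rw [abs_div _ 4, abs_mul _ (deriv f r / r), abs_of_pos (by positivity : (0:ℝ) < (1 + r ^ 2) ^ 2),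
         abs_of_pos (by norm_num : (0:ℝ) < 4)]
      have h1 : (1 + r ^ 2) ^ 2 * |deriv f r / r| / 4 ≤ (1 + r ^ 2) ^ 2 * |deriv f r / r| := div_le_self (by positivity) (by norm_num)
      have h2 : (1 + r ^ 2) ^ 2 * |deriv (deriv f) r| / 4 ≤ (1 + r ^ 2) ^ 2 * |deriv (deriv f) r| := div_le_self (by positivity) (by norm_num)
      have h3 : ((n:ℝ) + 11) / 2 * (1 + r ^ 2) * r * |deriv f r| ≤ ((n:ℝ) + 11) * (1 + r ^ 2) * (1 + r ^ 2) * |deriv f r| := by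
        gcongr
        linarith
      have h4 : ((n:ℝ) + 9) * (n + 11) / 4 * r ^ 2 * |f r| ≤ ((n:ℝ) + 9) * (n + 11) * (1 + r ^ 2) ^ 2 * |f r| := by
        gcongr
        · exact div_le_self (by positivity) (by norm_num)
      linarith
    calc Gf n r * _ ≤ Gf n r * ((1 + r ^ 2) ^ 2 * ((n + 11) * |deriv f r| + (n + 9) * (n + 11) * |f r| + |deriv (deriv f) r| + |deriv f r / r|)) := by gcongr
      _ = (n + 11) * (|deriv f r| * (Gf n r * (1 + r ^ 2) ^ 2)) + (n + 9) * (n + 11) * (|f r| * (Gf n r * (1 + r ^ 2) ^ 2))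
        + |deriv (deriv f) r| * (Gf n r * (1 + r ^ 2) ^ 2) + |deriv f r / r| * (Gf n r * (1 + r ^ 2) ^ 2) := by ring
      _ ≤ (n + 11) * C + (n + 9) * (n + 11) * C + C + C := by gcongr
      _ ≤ D := by
        rw [hD]
        have : 0 ≤ (1 + (n + 9)) * C := by positivity
        linarith

theorem lap_id (n : ℕ) (f : SchwartzMap ℝ ℝ) {r : ℝ} (hr : 0 < r) :
    pχ n f r + (-((n:ℝ) + 9) + 2 * (n + 11) / (1 + r ^ 2)) * pψ n f r
      - ((n:ℝ) + 9) / 2 * (1 + r ^ 2 + (n + 11) / 2) * pφ n f r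
    = (1 + r ^ 2) ^ 2 * Gf n r / 4 * (deriv (deriv f) r + (n + 12) * (deriv f r / r)) := by
  unfold pχ pψ pφ
  field_simp
  ring

end Rad

namespace Rad
open Set Filter Topology

theorem norm_d {N : ℕ} {x : Rn N} (hx : x ≠ 0) :
    HasFDerivAt (fun y : Rn N => ‖y‖) ((1 / ‖x‖) • innerSL ℝ x) x := by
  have h1 := (hasStrictFDerivAt_norm_sq x).hasFDerivAt.sqrt (by simpa using hx)
  have e : (fun y : Rn N => √(‖y‖ ^ 2)) = fun y => ‖y‖ := by
    ext y; exact Real.sqrt_sq (norm_nonneg y)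
  rw [e] at h1
  refine h1.congr_fderiv ?_
  rw [Real.sqrt_sq (norm_nonneg x)]
  ext v
  have : ‖x‖ ≠ 0 := by simpa using hx
  simp
  field_simp

theorem lapR_radial {N : ℕ} (g : Rn N → ℝ) (f : SchwartzMap ℝ ℝ) (hg : ∀ x, g x = f ‖x‖)
    {x : Rn N} (hx : x ≠ 0) :
    lapR g x = deriv (deriv f) ‖x‖ + ((N:ℝ) - 1) * (deriv f ‖x‖ / ‖x‖) := by
  have hge : g = fun x => f ‖x‖ := funext hg
  obtain ⟨L, hL⟩ : ∃ L : Rn N →L[ℝ] Rn N →L[ℝ] ℝ, ∀ x y, L x y = inner ℝ x y := ⟨innerSL ℝ, fun _ _ => rfl⟩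
  have hnd : ∀ y : Rn N, y ≠ 0 → HasFDerivAt (fun y : Rn N => ‖y‖) ((1 / ‖y‖) • L y) y := by
    intro y hy
    refine (norm_d hy).congr_fderiv ?_
    ext v
    rw [smul_apply, smul_apply, hL, innerSL_apply_apply]
  have h1 : ∀ y : Rn N, y ≠ 0 → HasFDerivAt g ((deriv f ‖y‖ / ‖y‖) • L y) y := by
    intro y hy
    rw [hge]
    refine ((schw_d f ‖y‖).comp_hasFDerivAt y (hnd y hy)).congr_fderiv ?_
    rw [smul_smul]; congr 1; ring
  have h2 : fderiv ℝ g =ᶠ[𝓝 x] fun y => (deriv f ‖y‖ / ‖y‖) • L y := by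
    filter_upwards [isOpen_ne.mem_nhds hx] with y hy
    exact (h1 y hy).fderiv
  have hr : ‖x‖ ≠ 0 := by simpa using hx
  have h3 := ((schw_d2 f ‖x‖).fun_div (hasDerivAt_id ‖x‖) hr).comp_hasFDerivAt x (hnd x hx)
  have h4 : HasFDerivAt (fun y : Rn N => L y) L x := L.hasFDerivAt
  have h5 := h3.fun_smul h4
  have h6 : fderiv ℝ (fderiv ℝ g) x = _ := (h5.congr_of_eventuallyEq h2).fderiv
  unfold lapR
  simp only [iteratedFDeriv_two_apply, h6]
  simp only [add_apply, smul_apply, ContinuousLinearMap.smulRight_apply,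
    hL, smul_eq_mul, Function.comp, id]
  have hs : ∑ i, (x i) ^ 2 = ‖x‖ ^ 2 := by rw [EuclideanSpace.norm_sq_eq]; simp
  have e : ∀ i : Fin N, inner ℝ x (EuclideanSpace.single i (1:ℝ)) = x i := by
    intro i; simp [EuclideanSpace.inner_single_right]
  have e' : ∀ i : Fin N, inner ℝ (EuclideanSpace.single i (1:ℝ)) (EuclideanSpace.single i (1:ℝ)) = (1:ℝ) := by
    intro i; simp
  simp only [e, e']
  rw [Finset.sum_add_distrib]
  simp only [mul_one, Finset.sum_const, Finset.card_univ, Fintype.card_fin, nsmul_eq_mul]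
  have e3 : ∀ i : Fin N, (deriv (deriv ⇑f) ‖x‖ * ‖x‖ - deriv (⇑f) ‖x‖) / ‖x‖ ^ 2 * (1 / ‖x‖ * x i) * x i
     = (deriv (deriv ⇑f) ‖x‖ * ‖x‖ - deriv (⇑f) ‖x‖) / ‖x‖ ^ 2 * (1 / ‖x‖) * (x i) ^ 2 := by intro i; ring
  simp only [e3]
  rw [← Finset.mul_sum, hs]
  field_simp
  ring

theorem profile (n : ℕ) (g : SchwartzMap (Rn (n + 13)) ℝ) (hg : ∀ x y : Rn (n + 13), ‖x‖ = ‖y‖ → g x = g y) :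
    ∃ f : SchwartzMap ℝ ℝ, (∀ r, f (-r) = f r) ∧ ∀ x, g x = f ‖x‖ := by
  set e : Rn (n + 13) := EuclideanSpace.single 0 1 with he
  have hn : ‖e‖ = 1 := by simp [he]
  let L : ℝ →L[ℝ] Rn (n + 13) := ContinuousLinearMap.toSpanSingleton ℝ e
  have hL : ∀ r, ‖L r‖ = |r| := by
    intro r; simp [L, norm_smul, hn]
  have hanti : AntilipschitzWith 1 L := by
    apply AddMonoidHomClass.antilipschitz_of_bound L
    intro r
    have := hL r
    rw [this, Real.norm_eq_abs]
    simp
  let f := SchwartzMap.compCLMOfAntilipschitz ℝ L.hasTemperateGrowth hanti g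
  have hf : ∀ r, f r = g (L r) := fun r => rfl
  refine ⟨f, ?_, ?_⟩
  · intro r; rw [hf, hf]; apply hg; rw [hL, hL, abs_neg]
  · intro x; rw [hf]; apply hg; rw [hL, abs_of_nonneg (norm_nonneg x)]

theorem polar (n : ℕ) : ∃ ω : ℝ, 0 < ω ∧ ∀ F : ℝ → ℝ, ∫ x : Rn (n + 13), F ‖x‖ = ω * ∫ r in Ioi (0:ℝ), r ^ (n + 12) * F r := by
  refine ⟨(n + 13) * (volume : Measure (Rn (n + 13))).real (Metric.ball 0 1), ?_, ?_⟩
  · have : 0 < (volume : Measure (Rn (n + 13))).real (Metric.ball 0 1) :=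
      ENNReal.toReal_pos (Metric.measure_ball_pos _ _ one_pos).ne' measure_ball_lt_top.ne
    positivity
  · intro F
    rw [integral_fun_norm_addHaar]
    simp [finrank_euclideanSpace]
    ring

theorem radial_data (n : ℕ) : ∃ ω : ℝ, 0 < ω ∧ ∀ g : SchwartzMap (Rn (n + 13)) ℝ,
    (∀ x y : Rn (n + 13), ‖x‖ = ‖y‖ → g x = g y) → ∃ φ ψ χ K, Tri φ ψ χ K ∧
      (∫ x, (lapR (⇑g) x) ^ 2 = ω * (16 * M (n + 12) (n + 13) (fun r => (χ r + (-((n:ℝ) + 9) + 2 * (n + 11) / (1 + r ^ 2)) * ψ r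
      - ((n:ℝ) + 9) / 2 * (1 + r ^ 2 + (n + 11) / 2) * φ r) ^ 2))) ∧
      (∫ x, ((1 + ‖x‖ ^ 2) ^ 4)⁻¹ * g x ^ 2 = ω * M (n + 12) (n + 13) (fun r => φ r ^ 2)) ∧
      (∫ x, (√(1 + ‖x‖ ^ 2) ^ (n + 17))⁻¹ * g x = ω * M (n + 12) (n + 13) φ) ∧
      (∫ x, (√(1 + ‖x‖ ^ 2) ^ (n + 9))⁻¹ * g x = ω * M (n + 12) (n + 9) φ) := by
  obtain ⟨ω, hω, hp⟩ := polar n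
  refine ⟨ω, hω, ?_⟩
  intro g hg
  obtain ⟨f, hev, hf⟩ := profile n g hg
  obtain ⟨K, hT⟩ := tri_of_schw n f hev
  refine ⟨_, _, _, K, hT, ?_, ?_, ?_, ?_⟩
  · have : ∫ x, (lapR (⇑g) x) ^ 2 = ∫ x : Rn (n + 13), (fun r => (deriv (deriv f) r + (n + 12) * (deriv f r / r)) ^ 2) ‖x‖ := by
      apply integral_congr_ae
      filter_upwards [compl_mem_ae_iff.mpr (measure_singleton (0 : Rn (n + 13)))] with x hx
      rw [lapR_radial g f hf hx]
      push_cast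
      ring
    rw [this.trans (hp (fun r => (deriv (deriv f) r + (n + 12) * (deriv f r / r)) ^ 2)), M]
    congr 1
    rw [← integral_const_mul]
    apply setIntegral_congr_fun measurableSet_Ioi
    intro r hr
    have hr : 0 < r := hr
    simp only
    rw [lap_id n f hr]
    have hG : Gf n r ^ 2 = (1 + r ^ 2) ^ (n + 9) := by
      unfold Gf; rw [← pow_mul, mul_comm, pow_mul, Real.sq_sqrt (by positivity)]
    have e2 : ((1 + r ^ 2) ^ 2 * Gf n r / 4 * (deriv (deriv f) r + (n + 12) * (deriv f r / r))) ^ 2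
      = (1 + r ^ 2) ^ 4 * (Gf n r ^ 2) / 16 * (deriv (deriv f) r + (n + 12) * (deriv f r / r)) ^ 2 := by ring
    rw [e2, hG]
    generalize (deriv (deriv f) r + (n + 12) * (deriv f r / r)) ^ 2 = X
    field_simp
    ring
  · have : ∫ x, ((1 + ‖x‖ ^ 2) ^ 4)⁻¹ * g x ^ 2 = ∫ x : Rn (n + 13), (fun r => ((1 + r ^ 2) ^ 4)⁻¹ * f r ^ 2) ‖x‖ := by
      simp only [hf]
    rw [this.trans (hp (fun r => ((1 + r ^ 2) ^ 4)⁻¹ * f r ^ 2)), M]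
    congr 1
    apply setIntegral_congr_fun measurableSet_Ioi
    intro r hr
    have hr : 0 < r := hr
    have hG : Gf n r ^ 2 = (1 + r ^ 2) ^ (n + 9) := by
      unfold Gf; rw [← pow_mul, mul_comm, pow_mul, Real.sq_sqrt (by positivity)]
    simp only [pφ, mul_pow, hG]
    field_simp
    ring
  · have : ∫ x, (√(1 + ‖x‖ ^ 2) ^ (n + 17))⁻¹ * g x = ∫ x : Rn (n + 13), (fun r => (√(1 + r ^ 2) ^ (n + 17))⁻¹ * f r) ‖x‖ := by
      simp only [hf]
    rw [this.trans (hp (fun r => (√(1 + r ^ 2) ^ (n + 17))⁻¹ * f r)), M]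
    congr 1
    apply setIntegral_congr_fun measurableSet_Ioi
    intro r hr
    have hr : 0 < r := hr
    simp only [pφ, Gf]
    have hs : √(1 + r ^ 2) ^ 2 = 1 + r ^ 2 := Real.sq_sqrt (by positivity)
    have h0 : 0 < √(1 + r ^ 2) := by positivity
    have e4 : (1 + r ^ 2) ^ (n + 13) = √(1 + r ^ 2) ^ (2 * (n + 13)) := by rw [pow_mul, hs]
    rw [e4]
    generalize √(1 + r ^ 2) = s at *
    field_simp
    ring
  · have : ∫ x, (√(1 + ‖x‖ ^ 2) ^ (n + 9))⁻¹ * g x = ∫ x : Rn (n + 13), (fun r => (√(1 + r ^ 2) ^ (n + 9))⁻¹ * f r) ‖x‖ := by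
      simp only [hf]
    rw [this.trans (hp (fun r => (√(1 + r ^ 2) ^ (n + 9))⁻¹ * f r)), M]
    congr 1
    apply setIntegral_congr_fun measurableSet_Ioi
    intro r hr
    have hr : 0 < r := hr
    simp only [pφ, Gf]
    have hs : √(1 + r ^ 2) ^ 2 = 1 + r ^ 2 := Real.sq_sqrt (by positivity)
    have h0 : 0 < √(1 + r ^ 2) := by positivity
    have e4 : (1 + r ^ 2) ^ (n + 9) = √(1 + r ^ 2) ^ (2 * (n + 9)) := by rw [pow_mul, hs]
    rw [e4]
    generalize √(1 + r ^ 2) = s at *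
    field_simp
    ring

end Rad

namespace Rad
open Set Filter Topology

theorem key (n : ℕ) : ∃ α C : ℝ, 0 < α ∧ 0 < C ∧ ∀ g : SchwartzMap (Rn (n + 13)) ℝ,
    (∀ x y : Rn (n + 13), ‖x‖ = ‖y‖ → g x = g y) →
    (((n:ℝ) + 9) * (n + 11) * (n + 13) * (n + 15) * (∫ x, ((1 + ‖x‖ ^ 2) ^ 4)⁻¹ * g x ^ 2) ≤ ∫ x, (lapR (⇑g) x) ^ 2) ∧
    (0 ≤ (∫ x, (lapR (⇑g) x) ^ 2) - ((n:ℝ) + 17) * (n + 11) * (n + 13) * (n + 15) * (∫ x, ((1 + ‖x‖ ^ 2) ^ 4)⁻¹ * g x ^ 2)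
      + α * (∫ x, (√(1 + ‖x‖ ^ 2) ^ (n + 17))⁻¹ * g x) ^ 2) ∧
    ((∫ x, (lapR (⇑g) x) ^ 2) ≤ C * (((∫ x, (lapR (⇑g) x) ^ 2) - ((n:ℝ) + 17) * (n + 11) * (n + 13) * (n + 15) * (∫ x, ((1 + ‖x‖ ^ 2) ^ 4)⁻¹ * g x ^ 2)
      + α * (∫ x, (√(1 + ‖x‖ ^ 2) ^ (n + 17))⁻¹ * g x) ^ 2) + (∫ x, (√(1 + ‖x‖ ^ 2) ^ (n + 17))⁻¹ * g x) ^ 2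
        + (∫ x, (√(1 + ‖x‖ ^ 2) ^ (n + 9))⁻¹ * g x) ^ 2)) := by
  obtain ⟨ω, hω, hrd⟩ := radial_data n
  obtain ⟨T, hT, htb⟩ := T_bd n
  have z0 : 0 < Zm (n + 12) (n + 13) := wt_pos _ _ (by omega)
  have hμ : (((n:ℝ) + 13) ^ 2 - 4) / 2 = (n + 11) * (n + 15) / 2 := by ring
  obtain ⟨μ, hμd⟩ : ∃ μ : ℝ, μ = (n + 11) * (n + 15) / 2 := ⟨_, rfl⟩
  obtain ⟨lam, hl⟩ : ∃ lam : ℝ, lam = ((n:ℝ) + 9) * (n + 11) * (n + 13) * (n + 15) / 16 := ⟨_, rfl⟩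
  obtain ⟨N, hN⟩ : ∃ N : ℝ, N = (n:ℝ) + 13 := ⟨_, rfl⟩
  have hμ0 : 0 < μ := by rw [hμd]; positivity
  have hl0 : 0 < lam := by rw [hl]; positivity
  have hN0 : 0 < N := by rw [hN]; positivity
  have hp : ((n:ℝ) + 17) * (n + 11) * (n + 13) * (n + 15) = 16 * (lam + μ * N) := by
    rw [hl, hμd, hN]; ring
  have hl' : ((n:ℝ) + 9) * (n + 11) * (n + 13) * (n + 15) = 16 * lam := by rw [hl]; ring
  refine ⟨16 * μ * N / (Zm (n + 12) (n + 13) * ω), (1 + (4 * μ + lam) * T) * (1 + 16 / ω), by positivity, by positivity, ?_⟩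
  intro g hg
  obtain ⟨φ, ψ, χ, K, hTri, e1, e2, e3, e4⟩ := hrd g hg
  have hen := hTri.energy n
  rw [hen] at e1
  have ht := htb hTri
  have hp1 : ((n:ℝ) + 13) * (M (n + 12) (n + 13) (fun r => φ r ^ 2) - M (n + 12) (n + 13) φ ^ 2 / Zm (n + 12) (n + 13))
      ≤ 4 * M (n + 14) (n + 15) (fun r => ψ r ^ 2) := hTri.p1 n
  have n0 := M_nonneg (n + 12) (n + 13) φ
  have n1 := M_nonneg (n + 14) (n + 15) ψ
  have n2 := M_nonneg (n + 12) (n + 13) χ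
  rw [hμ, ← hμd, ← hl] at e1
  rw [← hN] at hp1
  rw [hl', hp, e1, e2, e3, e4]
  generalize Zm (n + 12) (n + 13) = Z at *
  generalize M (n + 12) (n + 13) (fun r => φ r ^ 2) = I0 at *
  generalize M (n + 14) (n + 15) (fun r => ψ r ^ 2) = J1 at *
  generalize M (n + 12) (n + 13) (fun r => χ r ^ 2) = I2 at *
  generalize M (n + 12) (n + 13) φ = a at *
  generalize M (n + 12) (n + 9) φ = l at *
  clear e1 e2 e3 e4 hen hrd htb
  have hP : 16 * ω * I2 ≤ ω * (16 * (I2 + 4 * μ * J1 + lam * I0)) - 16 * (lam + μ * N) * (ω * I0)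
      + 16 * μ * N / (Z * ω) * (ω * a) ^ 2 := by
    have e : ω * (16 * (I2 + 4 * μ * J1 + lam * I0)) - 16 * (lam + μ * N) * (ω * I0)
      + 16 * μ * N / (Z * ω) * (ω * a) ^ 2 = 16 * ω * I2 + 16 * ω * μ * (4 * J1 - N * (I0 - a ^ 2 / Z)) := by
      field_simp
      ring
    rw [e]
    have : 0 ≤ 16 * ω * μ * (4 * J1 - N * (I0 - a ^ 2 / Z)) := by
      have := sub_nonneg.2 hp1
      positivity
    linarith
  refine ⟨?_, ?_, ?_⟩
  · have : 0 ≤ ω * (16 * (I2 + 4 * μ * J1)) := by positivity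
    nlinarith
  · exact le_trans (by positivity) hP
  · generalize ω * (16 * (I2 + 4 * μ * J1 + lam * I0)) - 16 * (lam + μ * N) * (ω * I0)
      + 16 * μ * N / (Z * ω) * (ω * a) ^ 2 = P at *
    have h1 : 4 * μ * J1 + lam * I0 ≤ (4 * μ + lam) * (I0 + J1) := by
      have : 0 ≤ 4 * μ * I0 + lam * J1 := by positivity
      nlinarith
    have h2 : (4 * μ + lam) * (I0 + J1) ≤ (4 * μ + lam) * (T * (I2 + a ^ 2 + l ^ 2)) := by gcongr
    have h3 : 0 ≤ a ^ 2 + l ^ 2 := by positivity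
    have h4 : I2 + 4 * μ * J1 + lam * I0 ≤ (1 + (4 * μ + lam) * T) * (I2 + a ^ 2 + l ^ 2) := by linarith
    calc ω * (16 * (I2 + 4 * μ * J1 + lam * I0)) ≤ ω * (16 * ((1 + (4 * μ + lam) * T) * (I2 + a ^ 2 + l ^ 2))) := by gcongr
      _ = (1 + (4 * μ + lam) * T) * (16 * ω * I2 + 16 / ω * ((ω * a) ^ 2 + (ω * l) ^ 2)) := by field_simp; ring
      _ ≤ (1 + (4 * μ + lam) * T) * ((1 + 16 / ω) * (P + (ω * a) ^ 2 + (ω * l) ^ 2)) := by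
        gcongr
        have h5 : 0 ≤ 16 / ω * P := by
          have : 0 ≤ P := le_trans (by positivity) hP
          positivity
        have h6 : 0 ≤ (ω * a) ^ 2 + (ω * l) ^ 2 := by positivity
        nlinarith
      _ = _ := by ring

theorem fin_alg (α C0 aY QY ν : ℝ) (hα : 0 < α) (hC0 : 0 < C0) (hQ : QY < 0) (hP : 0 ≤ QY + α * aY ^ 2) :
    ∃ c C : ℝ, 0 < c ∧ 0 < C ∧ ∀ p a y E l : ℝ, 0 ≤ p → (-ν * y + α * a * aY) ^ 2 ≤ p * (QY + α * aY ^ 2) →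
      E ≤ C0 * (p + a ^ 2 + l ^ 2) → p - α * a ^ 2 ≥ c * E - C * (l ^ 2 + y ^ 2) := by
  have ha : 0 < α * aY ^ 2 := by linarith
  have ha2 : 0 < aY ^ 2 := by
    by_contra h
    have : aY ^ 2 ≤ 0 := not_lt.1 h
    nlinarith
  obtain ⟨θ, hθ⟩ : ∃ θ, θ = (QY + α * aY ^ 2) / (α * aY ^ 2) := ⟨_, rfl⟩
  have hθ0 : 0 ≤ θ := by rw [hθ]; positivity
  have hθ1 : θ < 1 := by rw [hθ, div_lt_one ha]; linarith
  obtain ⟨η, hη⟩ : ∃ η, η = (1 - θ) / 2 := ⟨_, rfl⟩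
  have hη0 : 0 < η := by rw [hη]; linarith
  have hη1 : η ≤ 1 := by rw [hη]; linarith
  obtain ⟨K, hK⟩ : ∃ K, K = (1 + 1 / η) * ν ^ 2 / (α * aY ^ 2) := ⟨_, rfl⟩
  have hK0 : 0 ≤ K := by rw [hK]; positivity
  refine ⟨η / (C0 * (1 + 1 / α)), K + η * (K / α + 1) + 1, by positivity, by positivity, ?_⟩
  intro p a y E l hp hb hE
  have key : α * a ^ 2 ≤ (1 + η) * θ * p + K * y ^ 2 := by
    set b := -ν * y + α * a * aY with hbd
    have e1 : (α * aY ^ 2) * (α * a ^ 2) = (b + ν * y) ^ 2 := by rw [hbd]; ring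
    have e2 : (b + ν * y) ^ 2 ≤ (1 + η) * b ^ 2 + (1 + 1 / η) * (ν ^ 2 * y ^ 2) := by
      have : (1 + η) * b ^ 2 + (1 + 1 / η) * (ν ^ 2 * y ^ 2) - (b + ν * y) ^ 2 = (η * b - ν * y) ^ 2 / η := by
        field_simp; ring
      have h' : 0 ≤ (η * b - ν * y) ^ 2 / η := by positivity
      linarith
    have e3 : (1 + η) * b ^ 2 ≤ (1 + η) * (p * (QY + α * aY ^ 2)) := by gcongr
    have e4 : (α * aY ^ 2) * ((1 + η) * θ * p + K * y ^ 2) = (1 + η) * (p * (QY + α * aY ^ 2)) + (1 + 1 / η) * (ν ^ 2 * y ^ 2) := by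
      rw [hθ, hK]
      have : aY ≠ 0 := by intro h; simp [h] at ha2
      field_simp
    refine le_of_mul_le_mul_left ?_ ha
    linarith
  have k2 : (1 + η) * θ ≤ 1 - η := by
    have : θ = 1 - 2 * η := by rw [hη]; ring
    rw [this]; nlinarith
  have k3 : α * a ^ 2 ≤ (1 - η) * p + K * y ^ 2 := by
    have := mul_le_mul_of_nonneg_right k2 hp
    linarith
  have k4 : a ^ 2 ≤ (p + K * y ^ 2) / α := by
    rw [le_div_iff₀ hα]
    nlinarith [mul_nonneg hη0.le hp]
  have k5 : E / (C0 * (1 + 1 / α)) ≤ p + (K / α + 1) * (l ^ 2 + y ^ 2) := by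
    rw [div_le_iff₀ (by positivity)]
    refine hE.trans ?_
    have h1 : p + a ^ 2 + l ^ 2 ≤ (p + (K / α + 1) * (l ^ 2 + y ^ 2)) * (1 + 1 / α) := by
      have e : (p + (K / α + 1) * (l ^ 2 + y ^ 2)) * (1 + 1 / α) = p + (p + K * y ^ 2) / α + l ^ 2
        + (K / α * l ^ 2 + y ^ 2 + (K / α + 1) * (l ^ 2 + y ^ 2) / α) := by ring
      rw [e]
      have : 0 ≤ (K / α * l ^ 2 + y ^ 2 + (K / α + 1) * (l ^ 2 + y ^ 2) / α) := by positivity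
      linarith
    calc _ ≤ C0 * _ := mul_le_mul_of_nonneg_left h1 hC0.le
      _ = _ := by ring
  have k6 := mul_le_mul_of_nonneg_left k5 hη0.le
  have e7 : η / (C0 * (1 + 1 / α)) * E = η * (E / (C0 * (1 + 1 / α))) := by ring
  rw [e7]
  have : 0 ≤ K * l ^ 2 + l ^ 2 + y ^ 2 := by positivity
  nlinarith

theorem cs_quad {a b c : ℝ} (h : ∀ s : ℝ, 0 ≤ a + 2 * s * b + s ^ 2 * c) : b ^ 2 ≤ a * c := by
  have : discrim c (2 * b) a ≤ 0 := discrim_le_zero fun s => by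
    have := h s
    nlinarith
  unfold discrim at this
  nlinarith

end Rad

namespace Rad
open Set Filter Topology

theorem lap_schw {N : ℕ} (g : SchwartzMap (Rn N) ℝ) :
    lapR (⇑g) = ⇑(Laplacian.laplacian g : SchwartzMap (Rn N) ℝ) := by
  ext x
  rw [SchwartzMap.laplacian_apply,
    InnerProductSpace.laplacian_eq_iteratedFDeriv_orthonormalBasis _ (EuclideanSpace.basisFun (Fin N) ℝ)]
  unfold lapR
  refine Finset.sum_congr rfl fun i _ => ?_
  congr 1
  ext j
  fin_cases j <;> simp

theorem schw_bdd {N : ℕ} (g : SchwartzMap (Rn N) ℝ) : ∃ C, ∀ x, ‖g x‖ ≤ C := by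
  obtain ⟨C, hC⟩ := g.decay 0 0
  exact ⟨C, fun x => by simpa using hC.2 x⟩

theorem int1 {N : ℕ} {w : Rn N → ℝ} (hw : Continuous w) (hb : ∀ x, ‖w x‖ ≤ 1) (f : SchwartzMap (Rn N) ℝ) :
    Integrable (fun x => w x * f x) :=
  f.integrable.bdd_mul hw.aestronglyMeasurable (ae_of_all _ hb)

theorem int2 {N : ℕ} {w : Rn N → ℝ} (hw : Continuous w) (hb : ∀ x, ‖w x‖ ≤ 1) (f g : SchwartzMap (Rn N) ℝ) :
    Integrable (fun x => w x * (f x * g x)) := by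
  obtain ⟨C, hC⟩ := schw_bdd f
  have h : Integrable (fun x => f x * g x) :=
    g.integrable.bdd_mul f.continuous.aestronglyMeasurable (ae_of_all _ hC)
  exact h.bdd_mul hw.aestronglyMeasurable (ae_of_all _ hb)

theorem int2' {N : ℕ} (f g : SchwartzMap (Rn N) ℝ) : Integrable (fun x => f x * g x) := by
  simpa using int2 (w := fun _ => 1) continuous_const (by simp) f g

theorem expand2 {N : ℕ} {w : Rn N → ℝ} (hw : Continuous w) (hb : ∀ x, ‖w x‖ ≤ 1) (f g : SchwartzMap (Rn N) ℝ) (s : ℝ) :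
    ∫ x, w x * ((f + s • g) x) ^ 2 = (∫ x, w x * f x ^ 2) + 2 * s * (∫ x, w x * (f x * g x)) + s ^ 2 * ∫ x, w x * g x ^ 2 := by
  have i1 := int2 hw hb f f
  have i2 := int2 hw hb f g
  have i3 := int2 hw hb g g
  simp only [pow_two (f _), pow_two (g _)]
  have i12 : Integrable (fun x => w x * (f x * f x) + 2 * s * (w x * (f x * g x))) := i1.add (i2.const_mul _)
  rw [← integral_const_mul, ← integral_const_mul, ← integral_add i1 (i2.const_mul _),
    ← integral_add i12 (i3.const_mul _)]
  congr 1
  ext x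
  simp
  ring

theorem expand1 {N : ℕ} {w : Rn N → ℝ} (hw : Continuous w) (hb : ∀ x, ‖w x‖ ≤ 1) (f g : SchwartzMap (Rn N) ℝ) (s : ℝ) :
    ∫ x, w x * ((f + s • g) x) = (∫ x, w x * f x) + s * (∫ x, w x * g x) := by
  have i1 := int1 hw hb f
  have i2 := int1 hw hb g
  rw [← integral_const_mul, ← integral_add i1 (i2.const_mul _)]
  congr 1
  ext x
  simp
  ring

theorem expandE {N : ℕ} (f g : SchwartzMap (Rn N) ℝ) (s : ℝ) :
    ∫ x, lapR (⇑(f + s • g)) x ^ 2 = (∫ x, lapR (⇑f) x ^ 2) + 2 * s * (∫ x, lapR (⇑f) x * lapR (⇑g) x) + s ^ 2 * ∫ x, lapR (⇑g) x ^ 2 := by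
  have := expand2 (w := fun _ : Rn N => 1) continuous_const (by simp)
    (Laplacian.laplacian f : SchwartzMap (Rn N) ℝ) (Laplacian.laplacian g : SchwartzMap (Rn N) ℝ) s
  simp only [one_mul] at this
  simp only [lap_schw]
  rw [← this]
  have e : (Laplacian.laplacian (f + s • g) : SchwartzMap (Rn N) ℝ) = Laplacian.laplacian f + s • Laplacian.laplacian g := by
    have := map_add (LineDeriv.laplacianCLM ℝ (Rn N) (SchwartzMap (Rn N) ℝ)) f (s • g)
    rw [map_smul] at this
    exact this
  rw [e]

theorem w_bdd {N : ℕ} (k : ℕ) (x : Rn N) : ‖((1 + ‖x‖ ^ 2) ^ k)⁻¹‖ ≤ 1 := by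
  rw [Real.norm_of_nonneg (by positivity)]
  apply inv_le_one_of_one_le₀
  apply one_le_pow₀
  nlinarith [sq_nonneg ‖x‖]

theorem ws_bdd {N : ℕ} (k : ℕ) (x : Rn N) : ‖(√(1 + ‖x‖ ^ 2) ^ k)⁻¹‖ ≤ 1 := by
  rw [Real.norm_of_nonneg (by positivity)]
  apply inv_le_one_of_one_le₀
  apply one_le_pow₀
  rw [Real.one_le_sqrt]
  nlinarith [sq_nonneg ‖x‖]

theorem w_cont {N : ℕ} (k : ℕ) : Continuous fun x : Rn N => ((1 + ‖x‖ ^ 2) ^ k)⁻¹ := by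
  apply Continuous.inv₀ (by fun_prop)
  intro x; positivity

theorem ws_cont {N : ℕ} (k : ℕ) : Continuous fun x : Rn N => (√(1 + ‖x‖ ^ 2) ^ k)⁻¹ := by
  apply Continuous.inv₀ (by fun_prop)
  intro x; positivity

/-- pairing with the equation -/
theorem pairing {N : ℕ} (g Y Z : SchwartzMap (Rn N) ℝ) (c d : ℝ)
    (h : ∀ x, lapR (lapR (⇑Y)) x - c * ((1 + ‖x‖ ^ 2) ^ 4)⁻¹ * Y x = d * Z x) :
    (∫ x, lapR (⇑g) x * lapR (⇑Y) x) - c * (∫ x, ((1 + ‖x‖ ^ 2) ^ 4)⁻¹ * (g x * Y x)) = d * ∫ x, Z x * g x := by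
  have h1 := SchwartzMap.integral_mul_laplacian_right_eq_left (μ := volume) g (Laplacian.laplacian Y : SchwartzMap (Rn N) ℝ)
  simp only [lap_schw] at h ⊢
  rw [← h1, ← integral_const_mul, ← integral_const_mul, ← integral_sub (int2' _ _) ((int2 (w_cont 4) (w_bdd 4) g Y).const_mul _)]
  congr 1
  ext x
  linear_combination g x * h x

theorem W_pow (n : ℕ) (x : Rn (n + 13)) : Wfun (n + 13) x ^ ((8:ℝ) / (((n + 13 : ℕ) : ℝ) - 4))
    = ((n:ℝ) + 9) * (n + 11) * (n + 13) * (n + 15) * ((1 + ‖x‖ ^ 2) ^ 4)⁻¹ := by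
  have hN : (((n + 13 : ℕ) : ℝ)) = n + 13 := by push_cast; ring
  unfold Wfun
  rw [hN]
  have e : ((n:ℝ) + 13) * (n + 13 - 4) * ((n + 13) ^ 2 - 4) = (n + 9) * (n + 11) * (n + 13) * (n + 15) := by ring
  rw [e]
  have h9 : (n:ℝ) + 13 - 4 = n + 9 := by ring
  rw [h9]
  have h0 : (n:ℝ) + 9 ≠ 0 := by positivity
  rw [Real.mul_rpow (by positivity) (by positivity), ← Real.rpow_mul (by positivity), ← Real.rpow_mul (by positivity)]
  have e1 : ((n:ℝ) + 9) / 8 * (8 / (n + 9)) = 1 := by field_simp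
  have e2 : -(((n:ℝ) + 9) / 2) * (8 / (n + 9)) = -(4:ℕ) := by field_simp; norm_num
  rw [e1, e2, Real.rpow_one, Real.rpow_neg (by positivity), Real.rpow_natCast]

theorem W_eq (n : ℕ) : ∃ c : ℝ, 0 < c ∧ ∀ x : Rn (n + 13), Wfun (n + 13) x = c * (√(1 + ‖x‖ ^ 2) ^ (n + 9))⁻¹ := by
  refine ⟨((((n + 13 : ℕ) : ℝ)) * ((((n + 13 : ℕ) : ℝ)) - 4) * ((((n + 13 : ℕ) : ℝ)) ^ 2 - 4)) ^ (((((n + 13 : ℕ) : ℝ)) - 4) / 8), ?_, ?_⟩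
  · apply Real.rpow_pos_of_pos
    have e : ((((n + 13 : ℕ) : ℝ)) * ((((n + 13 : ℕ) : ℝ)) - 4) * ((((n + 13 : ℕ) : ℝ)) ^ 2 - 4)) = (n + 9) * (n + 11) * (n + 13) * (n + 15) := by push_cast; ring
    rw [e]; positivity
  · intro x
    unfold Wfun
    congr 1
    rw [Real.sqrt_eq_rpow, ← Real.rpow_natCast _ (n + 9), ← Real.rpow_mul (by positivity), ← Real.rpow_neg (by positivity)]
    congr 1
    push_cast
    ring

theorem rad_add {N : ℕ} {f g : SchwartzMap (Rn N) ℝ} (hf : ∀ x y : Rn N, ‖x‖ = ‖y‖ → f x = f y)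
    (hg : ∀ x y : Rn N, ‖x‖ = ‖y‖ → g x = g y) (s : ℝ) : ∀ x y : Rn N, ‖x‖ = ‖y‖ → (f + s • g) x = (f + s • g) y := by
  intro x y h
  simp [hf x y h, hg x y h]

theorem main (n : ℕ) (ν : ℝ) (hν : 0 < ν)
    (Y1 Y2 : SchwartzMap (Rn (n + 13)) ℝ)
    (hr1 : ∀ x y : Rn (n + 13), ‖x‖ = ‖y‖ → Y1 x = Y1 y)
    (hr2 : ∀ x y : Rn (n + 13), ‖x‖ = ‖y‖ → Y2 x = Y2 y)
    (hn1 : (∫ x, (Y1 x) ^ 2) = 1)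
    (he1 : ∀ x, lapR (lapR (⇑Y1)) x - (((n:ℝ) + 17) * (n + 11) * (n + 13) * (n + 15)) * ((1 + ‖x‖ ^ 2) ^ 4)⁻¹ * Y1 x = -ν * Y2 x)
    (he2 : ∀ x, lapR (lapR (⇑Y2)) x - (((n:ℝ) + 9) * (n + 11) * (n + 13) * (n + 15)) * ((1 + ‖x‖ ^ 2) ^ 4)⁻¹ * Y2 x = ν * Y1 x) :
    ∃ c C : ℝ, 0 < c ∧ 0 < C ∧ ∀ g : SchwartzMap (Rn (n + 13)) ℝ, (∀ x y : Rn (n + 13), ‖x‖ = ‖y‖ → g x = g y) →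
      (∫ x, (lapR (⇑g) x) ^ 2) - (((n:ℝ) + 17) * (n + 11) * (n + 13) * (n + 15)) * (∫ x, ((1 + ‖x‖ ^ 2) ^ 4)⁻¹ * g x ^ 2)
        ≥ c * (∫ x, (lapR (⇑g) x) ^ 2) - C * ((∫ x, (√(1 + ‖x‖ ^ 2) ^ (n + 9))⁻¹ * g x) ^ 2 + (∫ x, Y2 x * g x) ^ 2) := by
  obtain ⟨α, C0, hα, hC0, hk⟩ := key n
  generalize (((n:ℝ) + 17) * (n + 11) * (n + 13) * (n + 15)) = pl at *
  generalize (((n:ℝ) + 9) * (n + 11) * (n + 13) * (n + 15)) = l0 at *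
  have p1 := fun g => pairing g Y1 Y2 _ _ he1
  have p2 := fun g => pairing g Y2 Y1 _ _ he2
  -- positivity of the cross term
  have hY : 0 < ∫ x, Y1 x * Y2 x := by
    have a1 := p2 Y1
    have a2 := p2 Y2
    have q1 := (hk Y1 hr1).1
    simp only [← pow_two] at a1 a2
    rw [hn1] at a1
    have hcs := cs_quad (a := (∫ x, lapR (⇑Y1) x ^ 2) - l0 * ∫ x, ((1 + ‖x‖ ^ 2) ^ 4)⁻¹ * Y1 x ^ 2)
      (b := (∫ x, lapR (⇑Y1) x * lapR (⇑Y2) x) - l0 * (∫ x, ((1 + ‖x‖ ^ 2) ^ 4)⁻¹ * (Y1 x * Y2 x)))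
      (c := (∫ x, lapR (⇑Y2) x ^ 2) - l0 * ∫ x, ((1 + ‖x‖ ^ 2) ^ 4)⁻¹ * Y2 x ^ 2) (by
        intro s
        have := (hk _ (rad_add hr1 hr2 s)).1
        rw [expandE, expand2 (w_cont 4) (w_bdd 4)] at this
        linarith)
    rw [a1, a2] at hcs
    by_contra hneg
    have hneg := not_lt.1 hneg
    have : ν * (∫ x, Y1 x * Y2 x) ≤ 0 := mul_nonpos_of_nonneg_of_nonpos hν.le hneg
    have h3 := mul_nonpos_of_nonneg_of_nonpos (sub_nonneg.2 q1) this
    nlinarith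
  have b1 := p1 Y1
  simp only [← pow_two] at b1
  have hQ : (∫ x, lapR (⇑Y1) x ^ 2) - pl * (∫ x, ((1 + ‖x‖ ^ 2) ^ 4)⁻¹ * Y1 x ^ 2) < 0 := by
    rw [b1]
    simp only [mul_comm (Y2 _)]
    nlinarith
  obtain ⟨c, C, hc, hC, H⟩ := fin_alg α C0 (∫ x, (√(1 + ‖x‖ ^ 2) ^ (n + 17))⁻¹ * Y1 x) _ ν hα hC0 hQ (hk Y1 hr1).2.1
  refine ⟨c, C, hc, hC, ?_⟩
  intro g hg
  have hcs := cs_quad (a := (∫ x, lapR (⇑g) x ^ 2) - pl * (∫ x, ((1 + ‖x‖ ^ 2) ^ 4)⁻¹ * g x ^ 2) + α * (∫ x, (√(1 + ‖x‖ ^ 2) ^ (n + 17))⁻¹ * g x) ^ 2)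
      (b := (∫ x, lapR (⇑g) x * lapR (⇑Y1) x) - pl * (∫ x, ((1 + ‖x‖ ^ 2) ^ 4)⁻¹ * (g x * Y1 x)) + α * (∫ x, (√(1 + ‖x‖ ^ 2) ^ (n + 17))⁻¹ * g x) * (∫ x, (√(1 + ‖x‖ ^ 2) ^ (n + 17))⁻¹ * Y1 x))
      (c := (∫ x, lapR (⇑Y1) x ^ 2) - pl * (∫ x, ((1 + ‖x‖ ^ 2) ^ 4)⁻¹ * Y1 x ^ 2) + α * (∫ x, (√(1 + ‖x‖ ^ 2) ^ (n + 17))⁻¹ * Y1 x) ^ 2) (by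
        intro s
        have := (hk _ (rad_add hg hr1 s)).2.1
        rw [expandE, expand2 (w_cont 4) (w_bdd 4), expand1 (ws_cont (n + 17)) (ws_bdd (n + 17))] at this
        linarith)
  rw [p1 g] at hcs
  have := H _ _ _ _ _ (hk g hg).2.1 hcs (hk g hg).2.2
  linarith

end Rad

theorem stmt_13 (N : ℕ) (hN : 13 ≤ N) (ν : ℝ) (hν : 0 < ν)
    (Y1 Y2 : SchwartzMap (Rn N) ℝ)
    (hY1rad : ∀ x y : Rn N, ‖x‖ = ‖y‖ → Y1 x = Y1 y)
    (hY2rad : ∀ x y : Rn N, ‖x‖ = ‖y‖ → Y2 x = Y2 y)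
    (hY1norm : (∫ x : Rn N, (Y1 x) ^ 2) = 1)
    (hY2norm : (∫ x : Rn N, (Y2 x) ^ 2) = 1)
    (hY1eq : ∀ x : Rn N,
      lapR (lapR (⇑Y1)) x
          - (((N : ℝ) + 4) / ((N : ℝ) - 4)) * Wfun N x ^ ((8 : ℝ) / ((N : ℝ) - 4)) * Y1 x
        = -ν * Y2 x)
    (hY2eq : ∀ x : Rn N,
      lapR (lapR (⇑Y2)) x - Wfun N x ^ ((8 : ℝ) / ((N : ℝ) - 4)) * Y2 x = ν * Y1 x) :
    ∃ c C : ℝ, 0 < c ∧ 0 < C ∧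
      ∀ g : SchwartzMap (Rn N) ℝ,
        (∀ x y : Rn N, ‖x‖ = ‖y‖ → g x = g y) →
        (∫ x : Rn N, (lapR (⇑g) x) ^ 2)
            - (((N : ℝ) + 4) / ((N : ℝ) - 4))
              * (∫ x : Rn N, Wfun N x ^ ((8 : ℝ) / ((N : ℝ) - 4)) * (g x) ^ 2)
          ≥ c * (∫ x : Rn N, (lapR (⇑g) x) ^ 2)
            - C * ((∫ x : Rn N, Wfun N x * g x) ^ 2 + (∫ x : Rn N, Y2 x * g x) ^ 2) := by
  obtain ⟨n, rfl⟩ : ∃ n, N = n + 13 := ⟨N - 13, by omega⟩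
  have hpl : ((((n + 13 : ℕ) : ℝ)) + 4) / ((((n + 13 : ℕ) : ℝ)) - 4) * (((n:ℝ) + 9) * (n + 11) * (n + 13) * (n + 15))
      = ((n:ℝ) + 17) * (n + 11) * (n + 13) * (n + 15) := by
    have e1 : (((n + 13 : ℕ) : ℝ)) + 4 = n + 17 := by push_cast; ring
    have e2 : (((n + 13 : ℕ) : ℝ)) - 4 = n + 9 := by push_cast; ring
    rw [e1, e2]
    field_simp
  obtain ⟨w, hw, hW⟩ := Rad.W_eq n
  simp only [Rad.W_pow] at hY1eq hY2eq ⊢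
  obtain ⟨c, C, hc, hC, H⟩ := Rad.main n ν hν Y1 Y2 hY1rad hY2rad hY1norm
    (fun x => by rw [← hpl, ← hY1eq x]; ring) (fun x => by rw [← hY2eq x])
  refine ⟨c, C * (1 + 1 / w ^ 2), hc, by positivity, ?_⟩
  intro g hg
  have h := H g hg
  have e1 : ∫ x : Rn (n + 13), ((n:ℝ) + 9) * (n + 11) * (n + 13) * (n + 15) * ((1 + ‖x‖ ^ 2) ^ 4)⁻¹ * (g x) ^ 2
      = ((n:ℝ) + 9) * (n + 11) * (n + 13) * (n + 15) * ∫ x : Rn (n + 13), ((1 + ‖x‖ ^ 2) ^ 4)⁻¹ * (g x) ^ 2 := by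
    rw [← integral_const_mul]; congr 1; ext x; ring
  have e2 : ∫ x : Rn (n + 13), Wfun (n + 13) x * g x = w * ∫ x : Rn (n + 13), (√(1 + ‖x‖ ^ 2) ^ (n + 9))⁻¹ * g x := by
    rw [← integral_const_mul]; congr 1; ext x; rw [hW]; ring
  rw [e1, e2, ← mul_assoc, hpl]
  refine le_trans ?_ h
  generalize ∫ x : Rn (n + 13), (√(1 + ‖x‖ ^ 2) ^ (n + 9))⁻¹ * g x = l
  generalize ∫ x, Y2 x * g x = y
  have : C * (1 + 1 / w ^ 2) * ((w * l) ^ 2 + y ^ 2) = C * (l ^ 2 + y ^ 2) + C * ((w * l) ^ 2 + y ^ 2 / w ^ 2) := by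
    field_simp; ring
  rw [this]
  have : 0 ≤ C * ((w * l) ^ 2 + y ^ 2 / w ^ 2) := by positivity
  linarith
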